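/- arXiv:2206.13308 — 3 statements merged into one kernel-verified Lean document; each statement's English description precedes it below -/
import Mathlib

section
/- Let n ≥ 4 and 1 ≤ t ≤ n−3. Then neither Q_{n,t} nor G_{n,t} is isomorphic to the Artin group A(D_n) of type D_n. -/
/- Scaffolding: braid/commuting predicates, ordered products, cycle and twisted
cycle commutators, and the Artin groups of the diagrams `Δ_n`, `Δ_{t,n}`, `D_n`
(generators numbered `1, …, n` as in the paper, realized on the index type `Fin n`). -/

namespace ArtinPaper

open scoped commutatorElement

/-- `BR u v` : `u` and `v` braid, i.e. `u v u = v u v`. -/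
def BR {G : Type*} [Group G] (u v : G) : Prop := u * v * u = v * u * v

/-- `CM u v` : `u` and `v` commute, i.e. `u v = v u`. -/
def CM {G : Type*} [Group G] (u v : G) : Prop := u * v = v * u

/-- `mulIcc y a b = y a * y (a+1) * ⋯ * y b` (equal to `1` when `a > b`). -/
def mulIcc {M : Type*} [Monoid M] (y : ℕ → M) (a b : ℕ) : M :=
  ((List.range (b + 1 - a)).map fun i => y (a + i)).prod

/-- The cycle commutator
`cc(y₁,…,yₙ) = [y₁, y₂ ⋯ y_{n-1} yₙ y_{n-1}⁻¹ ⋯ y₂⁻¹]`. -/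
def cc {G : Type*} [Group G] (y : ℕ → G) (n : ℕ) : G :=
  ⁅y 1, mulIcc y 2 (n - 1) * y n * (mulIcc y 2 (n - 1))⁻¹⁆

/-- The `t`-twisted cycle commutator
`tc_t(y₁,…,yₙ) = [y₁, y₂⁻¹ ⋯ y_{t+1}⁻¹ y_{t+2} ⋯ y_{n-1} yₙ y_{n-1}⁻¹ ⋯ y_{t+2}⁻¹ y_{t+1} ⋯ y₂]`.
(The twisted cycle commutator `tc(y₁,y₂,y₃,y₄)` is `tc y 4 1`.) -/
def tc {G : Type*} [Group G] (y : ℕ → G) (n t : ℕ) : G :=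
  ⁅y 1, mulIcc (fun i => (y i)⁻¹) 2 (t + 1) *
      (mulIcc y (t + 2) (n - 1) * y n * (mulIcc y (t + 2) (n - 1))⁻¹) *
      (mulIcc (fun i => (y i)⁻¹) 2 (t + 1))⁻¹⁆

/-- The `i`-th generator (numbered `1, …, n`) of the free group on `Fin n`. -/
def gen (n i : ℕ) : FreeGroup (Fin n) :=
  if h : 0 < n then FreeGroup.of ⟨(i - 1) % n, Nat.mod_lt _ h⟩ else 1

/-- The braid relator `u v u (v u v)⁻¹`. -/
def braidRel {G : Type*} [Group G] (u v : G) : G := u * v * u * (v * u * v)⁻¹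

/-- Artin-type relations on generators `1, …, n` determined by an edge predicate `E`:
generators joined by an edge braid, all other pairs of generators commute. -/
def relsOf (n : ℕ) (E : ℕ → ℕ → Prop) : Set (FreeGroup (Fin n)) :=
  { w | ∃ i j, 1 ≤ i ∧ i < j ∧ j ≤ n ∧
      ((E i j ∧ w = braidRel (gen n i) (gen n j)) ∨
       (¬ E i j ∧ w = ⁅gen n i, gen n j⁆)) }

/-- Edges of the `n`-cycle `Δ_n`: `{i, i+1}` for `1 ≤ i ≤ n-1`, and `{1, n}`. -/
def cycEdge (n i j : ℕ) : Prop := (1 ≤ i ∧ i + 1 ≤ n ∧ j = i + 1) ∨ (i = 1 ∧ j = n)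

/-- Defining relations of the Artin group `A(Δ_n)` of the `n`-cycle. -/
def cycleRels (n : ℕ) : Set (FreeGroup (Fin n)) := relsOf n (cycEdge n)

/-- Edges of the diagram `Δ_{t,n}`, where `r = n - 3 - t` and the generators are
`b_1, …, b_{4+r}` (vertices `1, …, 4+r`) and `c_{5+r}, …, c_n` (vertices `5+r, …, n`):
the braiding pairs are `{b_1,b_2}, {b_2,b_3}, {b_3,b_1}, {b_4,b_1}, {b_1,b_5}`,
`{b_i,b_{i+1}}` for `5 ≤ i ≤ 3+r`, `{b_3,c_{5+r}}`, and `{c_i,c_{i+1}}` for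
`5+r ≤ i ≤ n-1`. -/
def deltaEdge (n t i j : ℕ) : Prop :=
  (i = 1 ∧ j = 2) ∨ (i = 2 ∧ j = 3) ∨ (i = 1 ∧ j = 3) ∨ (i = 1 ∧ j = 4) ∨
  (i = 1 ∧ j = 5 ∧ 5 ≤ 4 + (n - 3 - t)) ∨
  (5 ≤ i ∧ i + 1 ≤ 4 + (n - 3 - t) ∧ j = i + 1) ∨
  (i = 3 ∧ j = 5 + (n - 3 - t) ∧ 5 + (n - 3 - t) ≤ n) ∨
  (5 + (n - 3 - t) ≤ i ∧ i + 1 ≤ n ∧ j = i + 1)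

/-- Defining relations of the Artin group `A(Δ_{t,n})`. -/
def deltaRels (n t : ℕ) : Set (FreeGroup (Fin n)) := relsOf n (deltaEdge n t)

/-- Edges of the Coxeter diagram `D_n`: `{1,3}, {2,3}`, and `{i, i+1}` for
`3 ≤ i ≤ n-1` (in particular `1` and `2` are not joined, so `x_1 x_2 = x_2 x_1`). -/
def dEdge (n i j : ℕ) : Prop :=
  (i = 1 ∧ j = 3) ∨ (i = 2 ∧ j = 3) ∨ (3 ≤ i ∧ i + 1 ≤ n ∧ j = i + 1)

/-- Defining relations of the Artin group `A(D_n)` of type `D_n`. -/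
def dRels (n : ℕ) : Set (FreeGroup (Fin n)) := relsOf n (dEdge n)

/-- The Artin group `A(D_n)` of type `D_n`. -/
abbrev ArtinD (n : ℕ) := PresentedGroup (dRels n)

/-- `G_{n,t}`: the quotient of `A(Δ_n)` by the normal closure of the `t`-twisted
cycle commutator `tc_t(a_1, …, a_n)`. -/
abbrev Gnt (n t : ℕ) := PresentedGroup (cycleRels n ∪ {tc (gen n) n t})

/-- `Q_{n,t}`: the quotient of `A(Δ_{t,n})` by the normal closure of the twisted
cycle commutator `tc(b_1, b_2, b_3, b_4)`. -/
abbrev Qnt (n t : ℕ) := PresentedGroup (deltaRels n t ∪ {tc (gen n) 4 1})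

section Words

variable {G H : Type*} [Group G] [Group H]

theorem mulIcc_of_lt {M : Type*} [Monoid M] (y : ℕ → M) {a b : ℕ} (h : b < a) :
    mulIcc y a b = 1 := by
  simp [mulIcc, Nat.sub_eq_zero_of_le (Nat.succ_le_of_lt h)]

theorem mulIcc_succ {M : Type*} [Monoid M] (y : ℕ → M) {a b : ℕ} (h : a ≤ b + 1) :
    mulIcc y a (b + 1) = mulIcc y a b * y (b + 1) := by
  have h1 : b + 1 + 1 - a = (b + 1 - a) + 1 := by omega
  have h2 : a + (b + 1 - a) = b + 1 := by omega
  simp [mulIcc, h1, List.range_succ, h2]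

theorem mulIcc_self {M : Type*} [Monoid M] (y : ℕ → M) (a : ℕ) : mulIcc y a a = y a := by
  simp [mulIcc]

theorem map_mulIcc {M N : Type*} [Monoid M] [Monoid N] (φ : M →* N) (y : ℕ → M) (a b : ℕ) :
    φ (mulIcc y a b) = mulIcc (fun i => φ (y i)) a b := by
  simp [mulIcc, map_list_prod, Function.comp_def]

theorem mulIcc_congr {M : Type*} [Monoid M] {y y' : ℕ → M} {a b : ℕ}
    (h : ∀ i, a ≤ i → i ≤ b → y i = y' i) : mulIcc y a b = mulIcc y' a b := by
  unfold mulIcc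
  congr 1
  refine List.map_congr_left fun i hi => h _ (by omega) ?_
  have := List.mem_range.1 hi
  omega

theorem mul_mulIcc_shift {M : Type*} [Monoid M] (y : ℕ → M) {a b : ℕ} (h : a ≤ b + 1) :
    y a * mulIcc (fun i => y (i + 1)) a b = mulIcc y a (b + 1) := by
  have h1 : b + 1 + 1 - a = (b + 1 - a) + 1 := by omega
  have h2 : ∀ i, a + i + 1 = a + (i + 1) := fun i => by omega
  simp only [mulIcc, h1, List.range_succ_eq_map, List.map_cons, List.map_map, List.prod_cons,
    Function.comp_def, Nat.succ_eq_add_one, h2, add_zero]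

theorem map_tc (φ : G →* H) (y : ℕ → G) (n t : ℕ) :
    φ (tc y n t) = tc (fun i => φ (y i)) n t := by
  simp [tc, map_commutatorElement, map_mulIcc]

theorem tc_eq_one_iff (y : ℕ → G) (n t : ℕ) :
    tc y n t = 1 ↔ Commute (y 1) (mulIcc (fun i => (y i)⁻¹) 2 (t + 1) *
      (mulIcc y (t + 2) (n - 1) * y n * (mulIcc y (t + 2) (n - 1))⁻¹) *
      (mulIcc (fun i => (y i)⁻¹) 2 (t + 1))⁻¹) :=
  commutatorElement_eq_one_iff_commute

/-- Elements `x 1, …, x n` satisfying the Artin relations of the diagram with edges `E`. -/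
structure ArtinRel (n : ℕ) (E : ℕ → ℕ → Prop) (x : ℕ → G) : Prop where
  braid : ∀ {i j}, 1 ≤ i → i < j → j ≤ n → E i j → x i * x j * x i = x j * x i * x j
  comm : ∀ {i j}, 1 ≤ i → i < j → j ≤ n → ¬ E i j → Commute (x i) (x j)

theorem artinRel_mk {n : ℕ} {E : ℕ → ℕ → Prop} {rels : Set (FreeGroup (Fin n))}
    (h : relsOf n E ⊆ rels) : ArtinRel n E fun i => PresentedGroup.mk rels (gen n i) where
  braid {i j} h1 h2 h3 hE := by
    have := PresentedGroup.one_of_mem (h ⟨i, j, h1, h2, h3, Or.inl ⟨hE, rfl⟩⟩)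
    rw [braidRel, map_mul, map_inv, mul_inv_eq_one] at this
    simpa using this
  comm {i j} h1 h2 h3 hE := by
    have := PresentedGroup.one_of_mem (h ⟨i, j, h1, h2, h3, Or.inr ⟨hE, rfl⟩⟩)
    rwa [map_commutatorElement, commutatorElement_eq_one_iff_commute] at this

theorem gen_eq_of {n : ℕ} (k : Fin n) : gen n (k + 1) = FreeGroup.of k := by
  have h : 0 < n := k.pos
  simp [gen, h, Nat.mod_eq_of_lt k.isLt]

theorem lift_gen {n : ℕ} (x : ℕ → G) {i : ℕ} (h1 : 1 ≤ i) (h2 : i ≤ n) :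
    FreeGroup.lift (fun k : Fin n => x (k + 1)) (gen n i) = x i := by
  obtain ⟨j, rfl⟩ : ∃ j, i = j + 1 := ⟨i - 1, by omega⟩
  rw [gen_eq_of ⟨j, h2⟩]
  simp

theorem ArtinRel.lift_eq_one {n : ℕ} {E : ℕ → ℕ → Prop} {x : ℕ → G} (h : ArtinRel n E x)
    {r : FreeGroup (Fin n)} (hr : r ∈ relsOf n E) :
    FreeGroup.lift (fun k : Fin n => x (k + 1)) r = 1 := by
  obtain ⟨i, j, h1, h2, h3, ⟨hE, rfl⟩ | ⟨hE, rfl⟩⟩ := hr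
  · rw [braidRel, map_mul, map_inv, mul_inv_eq_one]
    simp only [map_mul, lift_gen x h1 (by omega : i ≤ n), lift_gen x (by omega : 1 ≤ j) h3]
    exact h.braid h1 h2 h3 hE
  · rw [map_commutatorElement, commutatorElement_eq_one_iff_commute,
      lift_gen x h1 (by omega : i ≤ n), lift_gen x (by omega : 1 ≤ j) h3]
    exact h.comm h1 h2 h3 hE

theorem mk_gen_induction {n : ℕ} {rels : Set (FreeGroup (Fin n))}
    (K : Subgroup (PresentedGroup rels))
    (h : ∀ i, 1 ≤ i → i ≤ n → PresentedGroup.mk rels (gen n i) ∈ K)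
    (g : PresentedGroup rels) : g ∈ K := by
  refine PresentedGroup.generated_by rels K (fun k => ?_) g
  have := h (k + 1) (by omega) k.isLt
  rwa [gen_eq_of] at this

theorem eq_of_braid_of_commute {a b : G} (h1 : a * b * a = b * a * b) (h2 : Commute a b) :
    a = b := by
  rw [h2.eq] at h1
  exact mul_left_cancel (a := b * a) h1

end Words

section CentralElement

variable {G : Type*} [Group G] {n : ℕ} {x : ℕ → G}

/-- The product `x_1 x_2 x_3 ⋯ x_n` of the standard generators of type `D_n`. -/
def coxeterD (x : ℕ → G) (n : ℕ) : G := x 1 * x 2 * mulIcc x 3 n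

/-- The first two generators of type `D_n`, extended alternately to all indices. -/
def forkD {G : Type*} (x : ℕ → G) (k : ℕ) : G := if Even k then x 1 else x 2

theorem forkD_add_two {G : Type*} (x : ℕ → G) (k : ℕ) : forkD x (k + 2) = forkD x k := by
  simp [forkD, Nat.even_add]

theorem ArtinRel.forkD_braid (h : ArtinRel n (dEdge n) x) (hn : 4 ≤ n) (k : ℕ) :
    forkD x k * x 3 * forkD x k = x 3 * forkD x k * x 3 := by
  unfold forkD
  split_ifs
  · exact h.braid le_rfl (by omega) (by omega) (by simp [dEdge])
  · exact h.braid (by omega) (by omega) (by omega) (by simp [dEdge])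

theorem ArtinRel.forkD_comm (h : ArtinRel n (dEdge n) x) (k : ℕ) {i : ℕ} (h4 : 4 ≤ i)
    (hi : i ≤ n) : Commute (forkD x k) (x i) := by
  unfold forkD
  split_ifs
  · exact h.comm le_rfl (by omega) hi (by simp only [dEdge]; omega)
  · exact h.comm (by omega) (by omega) hi (by simp only [dEdge]; omega)

theorem ArtinRel.commute_one_two (h : ArtinRel n (dEdge n) x) (hn : 4 ≤ n) :
    Commute (x 1) (x 2) :=
  h.comm le_rfl (by omega) (by omega) (by simp [dEdge])

theorem ArtinRel.forkD_mul (h : ArtinRel n (dEdge n) x) (hn : 4 ≤ n) (k : ℕ) :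
    x 1 * x 2 = forkD x (k + 1) * forkD x k := by
  by_cases hk : Even k
  · simp [forkD, hk, Nat.even_add_one, (h.commute_one_two hn).eq]
  · simp [forkD, hk, Nat.even_add_one]

theorem ArtinRel.forkD_commute (h : ArtinRel n (dEdge n) x) (hn : 4 ≤ n) (k : ℕ) :
    Commute (forkD x (k + 1)) (forkD x k) := by
  by_cases hk : Even k
  · simpa [forkD, hk, Nat.even_add_one] using (h.commute_one_two hn).symm
  · simpa [forkD, hk, Nat.even_add_one] using h.commute_one_two hn

theorem ArtinRel.mulIcc_mul (h : ArtinRel n (dEdge n) x) {m i : ℕ} (hi : 3 ≤ i) (him : i + 1 ≤ m)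
    (hm : m ≤ n) : mulIcc x 3 m * x i = x (i + 1) * mulIcc x 3 m := by
  induction m, him using Nat.le_induction with
  | base =>
    obtain ⟨j, rfl⟩ : ∃ j, i = j + 1 := ⟨i - 1, by omega⟩
    have key : ∀ m, m ≤ j → Commute (x (j + 1 + 1)) (mulIcc x 3 m) := by
      intro m hmj
      induction m with
      | zero => rw [mulIcc_of_lt _ (by omega)]; exact Commute.one_right _
      | succ m ih =>
        by_cases h3 : 3 ≤ m + 1
        · rw [mulIcc_succ _ h3]
          refine (ih (by omega)).mul_right (h.comm (by omega) (by omega) (by omega) ?_).symm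
          simp only [dEdge]; omega
        · rw [mulIcc_of_lt _ (by omega)]; exact Commute.one_right _
    have hb := h.braid (i := j + 1) (j := j + 1 + 1) (by omega) (by omega) (by omega)
      (Or.inr (Or.inr ⟨by omega, by omega, rfl⟩))
    rw [mulIcc_succ _ (by omega), mulIcc_succ _ (by omega),
      mul_assoc (_ * _), mul_assoc, ← mul_assoc (x (j + 1)), hb, ← mul_assoc, ← mul_assoc,
      ← (key j le_rfl).eq]
    simp only [mul_assoc]
  | succ m him ih =>
    have hc : Commute (x i) (x (m + 1)) := by
      refine h.comm (by omega) (by omega) (by omega) ?_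
      simp only [dEdge]; omega
    rw [mulIcc_succ _ (by omega), mul_assoc, ← hc.eq, ← mul_assoc, ih (by omega), mul_assoc]

theorem ArtinRel.conj_coxeterD (h : ArtinRel n (dEdge n) x) (hn : 4 ≤ n) {i : ℕ} (hi : 3 ≤ i)
    (hin : i < n) : MulAut.conj (coxeterD x n) (x i) = x (i + 1) := by
  rw [MulAut.conj_apply, mul_inv_eq_iff_eq_mul, coxeterD, mul_assoc, h.mulIcc_mul hi hin le_rfl,
    h.forkD_mul hn 0, ← mul_assoc, ← mul_assoc,
    (((h.forkD_comm 1 (i := i + 1) (by omega) hin).mul_left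
      (h.forkD_comm 0 (by omega) hin))).eq]

theorem ArtinRel.mulIcc_mul_forkD (h : ArtinRel n (dEdge n) x) (k : ℕ) {m : ℕ} (hm : 3 ≤ m)
    (hmn : m ≤ n) :
    mulIcc x 3 m * forkD x k = x 3 * forkD x k * (x 3)⁻¹ * mulIcc x 3 m := by
  induction m, hm using Nat.le_induction with
  | base => simp [mulIcc_self]
  | succ m hm ih =>
    rw [mulIcc_succ _ (by omega), mul_assoc, ← (h.forkD_comm k (by omega) hmn).eq, ← mul_assoc,
      ih (by omega), mul_assoc]

theorem ArtinRel.conj_coxeterD_forkD (h : ArtinRel n (dEdge n) x) (hn : 4 ≤ n) (k : ℕ) :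
    MulAut.conj (coxeterD x n) (forkD x k) = (x 3)⁻¹ * forkD x (k + 1) * x 3 := by
  have h1 : x 3 * forkD x k * (x 3)⁻¹ = (forkD x k)⁻¹ * x 3 * forkD x k := by
    rw [mul_inv_eq_iff_eq_mul, mul_assoc, mul_assoc, eq_inv_mul_iff_mul_eq, ← mul_assoc,
      ← mul_assoc, h.forkD_braid hn]
  have h2 : (x 3)⁻¹ * forkD x (k + 1) * x 3 = forkD x (k + 1) * x 3 * (forkD x (k + 1))⁻¹ := by
    rw [eq_mul_inv_iff_mul_eq, mul_assoc, mul_assoc, inv_mul_eq_iff_eq_mul, ← mul_assoc,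
      ← mul_assoc, h.forkD_braid hn]
  rw [MulAut.conj_apply, mul_inv_eq_iff_eq_mul, coxeterD, mul_assoc,
    h.mulIcc_mul_forkD k (by omega) le_rfl, h1, h2, h.forkD_mul hn k]
  simp only [mul_assoc, mul_inv_cancel_left, inv_mul_cancel_left]

theorem ArtinRel.conj_coxeterD_pow (h : ArtinRel n (dEdge n) x) (hn : 4 ≤ n) (j : ℕ) {k : ℕ}
    (hk : k + 2 ≤ n) :
    MulAut.conj (coxeterD x n ^ k) (forkD x j) =
      (mulIcc x 3 (k + 2))⁻¹ * forkD x (j + k) * mulIcc x 3 (k + 2) := by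
  induction k with
  | zero => simp [mulIcc_of_lt]
  | succ k ih =>
    have h1 : MulAut.conj (coxeterD x n) (mulIcc x 3 (k + 2)) =
        mulIcc (fun i => x (i + 1)) 3 (k + 2) := by
      have := map_mulIcc (MulAut.conj (coxeterD x n)).toMonoidHom x 3 (k + 2)
      refine this.trans (mulIcc_congr fun i h3 hi => ?_)
      exact h.conj_coxeterD hn h3 (by omega)
    rw [pow_succ', map_mul, MulAut.mul_apply, ih (by omega), map_mul, map_mul, map_inv, h1,
      h.conj_coxeterD_forkD hn, show k + 1 + 2 = k + 2 + 1 by omega,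
      ← mul_mulIcc_shift x (by omega : 3 ≤ k + 2 + 1)]
    simp only [mul_inv_rev, mul_assoc, add_assoc]

theorem ArtinRel.conj_coxeterD_pow_pred (h : ArtinRel n (dEdge n) x) (hn : 4 ≤ n) (j : ℕ) :
    MulAut.conj (coxeterD x n ^ (n - 1)) (forkD x j) = forkD x (j + n) := by
  obtain ⟨m, rfl⟩ : ∃ m, n = m + 2 := ⟨n - 2, by omega⟩
  have hc : Commute (x 1 * x 2) (forkD x (j + m)) := by
    rw [h.forkD_mul hn (j + m)]
    exact (h.forkD_commute hn _).mul_left (Commute.refl _)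
  rw [show m + 2 - 1 = m + 1 by omega, pow_succ', map_mul, MulAut.mul_apply,
    h.conj_coxeterD_pow hn j le_rfl, MulAut.conj_apply, coxeterD, ← add_assoc, forkD_add_two]
  calc _ = (x 1 * x 2) * forkD x (j + m) * (x 1 * x 2)⁻¹ := by group
    _ = _ := by rw [hc.eq, mul_inv_cancel_right]

theorem ArtinRel.commute_of_commute_coxeterD (h : ArtinRel n (dEdge n) x) (hn : 4 ≤ n) {z : G}
    (hc : Commute z (coxeterD x n)) (h1 : Commute z (x 1)) (h2 : Commute z (x 2)) {i : ℕ}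
    (hi : 1 ≤ i) (hin : i ≤ n) : Commute z (x i) := by
  have h3 : Commute z (x 3) := by
    have e : x 3 = (x 2)⁻¹ * (coxeterD x n * x 1 * (coxeterD x n)⁻¹) * x 2 := by
      have e0 := h.conj_coxeterD_forkD hn 0
      have e1 := h.forkD_braid hn 1
      simp only [forkD, MulAut.conj_apply] at e0 e1
      simp only [Even.zero, if_true, zero_add, Nat.not_even_one, if_false] at e0 e1
      rw [e0]
      simp only [mul_assoc] at e1 ⊢
      rw [e1, inv_mul_cancel_left, inv_mul_cancel_left]
    rw [e]
    exact (h2.inv_right.mul_right ((hc.mul_right h1).mul_right hc.inv_right)).mul_right h2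
  have key : ∀ i, 3 ≤ i → i ≤ n → Commute z (x i) := by
    intro i hi
    induction i, hi using Nat.le_induction with
    | base => exact fun _ => h3
    | succ i hi ih =>
      intro hin
      rw [← h.conj_coxeterD hn hi hin, MulAut.conj_apply]
      exact (hc.mul_right (ih (by omega))).mul_right hc.inv_right
  rcases (by omega : i = 1 ∨ i = 2 ∨ 3 ≤ i) with rfl | rfl | hi
  exacts [h1, h2, key i hi hin]

theorem ArtinRel.coxeterD_pow_commute_of_even (h : ArtinRel n (dEdge n) x) (hn : 4 ≤ n)
    (he : Even n) {i : ℕ} (hi : 1 ≤ i) (hin : i ≤ n) :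
    Commute (coxeterD x n ^ (n - 1)) (x i) := by
  have key : ∀ j, Commute (coxeterD x n ^ (n - 1)) (forkD x j) := fun j => by
    have := h.conj_coxeterD_pow_pred hn j
    rw [MulAut.conj_apply, mul_inv_eq_iff_eq_mul] at this
    rw [Commute, SemiconjBy, this]
    simp [forkD, Nat.even_add, he]
  exact h.commute_of_commute_coxeterD hn (Commute.pow_self _ _) (by simpa [forkD] using key 0)
    (by simpa [forkD] using key 1) hi hin

theorem ArtinRel.coxeterD_pow_commute (h : ArtinRel n (dEdge n) x) (hn : 4 ≤ n)
    {i : ℕ} (hi : 1 ≤ i) (hin : i ≤ n) :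
    Commute (coxeterD x n ^ ((n - 1) * 2)) (x i) := by
  have key : ∀ j, Commute (coxeterD x n ^ ((n - 1) * 2)) (forkD x j) := fun j => by
    have h2 : MulAut.conj (coxeterD x n ^ ((n - 1) * 2)) (forkD x j) = forkD x j := by
      rw [pow_mul, pow_two, map_mul, MulAut.mul_apply, h.conj_coxeterD_pow_pred hn,
        h.conj_coxeterD_pow_pred hn]
      simp [forkD, Nat.even_add]
      by_cases hj : Even j <;> by_cases hn : Even n <;> simp [hj, hn]
    rwa [MulAut.conj_apply, mul_inv_eq_iff_eq_mul] at h2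
  exact h.commute_of_commute_coxeterD hn (Commute.pow_self _ _) (by simpa [forkD] using key 0)
    (by simpa [forkD] using key 1) hi hin

end CentralElement

section TwistedTriangle

theorem Qnt_mk_gen_eq {n t : ℕ} (hn : 4 ≤ n) {i : ℕ} (hi : 1 ≤ i) (hin : i ≤ n) :
    PresentedGroup.mk (deltaRels n t ∪ {tc (gen n) 4 1}) (gen n i) =
      PresentedGroup.mk (deltaRels n t ∪ {tc (gen n) 4 1}) (gen n 1) := by
  have h := artinRel_mk (n := n) (E := deltaEdge n t)
    (rels := deltaRels n t ∪ {tc (gen n) 4 1}) Set.subset_union_left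
  have htc := PresentedGroup.one_of_mem (rels := deltaRels n t ∪ {tc (gen n) 4 1})
    (x := tc (gen n) 4 1) (Or.inr rfl)
  rw [map_tc] at htc
  set b : ℕ → Qnt n t :=
    fun i => PresentedGroup.mk (deltaRels n t ∪ {tc (gen n) 4 1}) (gen n i) with hb
  change b i = b 1
  have h24 : Commute (b 2) (b 4) :=
    h.comm (by omega) (by omega) (by omega) (by simp only [deltaEdge]; omega)
  have h34 : Commute (b 3) (b 4) :=
    h.comm (by omega) (by omega) (by omega) (by simp only [deltaEdge]; omega)
  have h14 : b 1 = b 4 := by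
    refine eq_of_braid_of_commute
      (h.braid (i := 1) (j := 4) le_rfl (by omega) (by omega) (by simp [deltaEdge])) ?_
    rw [tc_eq_one_iff] at htc
    simp only [Nat.reduceAdd, Nat.reduceSub, mulIcc_self] at htc
    rwa [h34.eq, mul_inv_cancel_right, h24.inv_left.eq, mul_inv_cancel_right] at htc
  have h4 : ∀ i, 1 ≤ i → i ≤ n → i ≠ 1 → Commute (b i) (b 1) := by
    intro i hi hin h1
    rw [h14]
    rcases lt_trichotomy i 4 with hi4 | rfl | hi4
    · exact h.comm hi hi4 (by omega) (by simp only [deltaEdge]; omega)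
    · exact Commute.refl _
    · exact (h.comm (by omega) hi4 hin (by simp only [deltaEdge]; omega)).symm
  induction i using Nat.strong_induction_on with
  | _ i ih =>
    by_cases h1 : i = 1
    · rw [h1]
    by_cases h4' : i = 4
    · rw [h4', h14]
    obtain ⟨j, hj1, hji, hE⟩ : ∃ j, 1 ≤ j ∧ j < i ∧ deltaEdge n t j i := by
      simp only [deltaEdge]
      by_cases h2 : i = 2 ∨ i = 3
      · exact ⟨1, by omega, by omega, by omega⟩
      by_cases h5 : i = 5 + (n - 3 - t)
      · exact ⟨3, by omega, by omega, by omega⟩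
      by_cases h6 : i = 5
      · exact ⟨1, by omega, by omega, by omega⟩
      exact ⟨i - 1, by omega, by omega, by omega⟩
    have hbr := h.braid hj1 hji hin hE
    rw [ih j hji hj1 (by omega)] at hbr
    exact (eq_of_braid_of_commute hbr (h4 i hi hin h1).symm).symm

theorem Qnt_commute {n t : ℕ} (hn : 4 ≤ n) (g h : Qnt n t) : Commute g h := by
  have key : ∀ g : Qnt n t, g ∈ Subgroup.zpowers
      (PresentedGroup.mk (deltaRels n t ∪ {tc (gen n) 4 1}) (gen n 1)) := by
    refine mk_gen_induction _ fun i hi hin => ?_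
    rw [Qnt_mk_gen_eq hn hi hin]
    exact Subgroup.mem_zpowers _
  obtain ⟨k, rfl⟩ := key g
  obtain ⟨l, rfl⟩ := key h
  exact Commute.zpow_zpow_self _ _ _

theorem swap_braid {α : Type*} [DecidableEq α] {a b c : α} (hab : a ≠ b) (hbc : b ≠ c)
    (hac : a ≠ c) : Equiv.swap a b * Equiv.swap b c * Equiv.swap a b =
      Equiv.swap b c * Equiv.swap a b * Equiv.swap b c := by
  have h1 := Equiv.swap_mul_swap_mul_swap hbc.symm hac.symm
  have h2 := Equiv.swap_mul_swap_mul_swap hab hac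
  rw [Equiv.swap_comm b a, Equiv.swap_comm c b, Equiv.swap_comm a c] at h1
  rw [h1, h2]

theorem artinRel_swap (n : ℕ) :
    ArtinRel n (dEdge n) fun i => Equiv.swap (max 2 i - 1) (max 2 i) where
  braid {i j} hi hij hj hE := by
    obtain ⟨k, hk, hj⟩ : ∃ k, max 2 i = k + 1 ∧ j = k + 2 := by
      simp only [dEdge] at hE
      exact ⟨max 2 i - 1, by omega, by omega⟩
    have hk' : max 2 (k + 2) = k + 2 := by omega
    simp only [hk, hj, hk']
    exact swap_braid (by omega) (by omega) (by omega)
  comm {i j} hi hij hj hE := by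
    by_cases h2 : j = 2
    · obtain rfl : i = 1 := by omega
      subst h2
      exact Commute.refl _
    simp only [dEdge] at hE
    refine Equiv.Perm.Disjoint.commute fun m => ?_
    by_cases hm : m = max 2 i - 1 ∨ m = max 2 i
    · exact Or.inr (Equiv.swap_apply_of_ne_of_ne (by omega) (by omega))
    · exact Or.inl (Equiv.swap_apply_of_ne_of_ne (by omega) (by omega))

theorem ArtinD_not_comm {n : ℕ} (hn : 4 ≤ n) : ¬ ∀ g h : ArtinD n, Commute g h := by
  intro hc
  have h := artinRel_mk (n := n) (E := dEdge n) (rels := dRels n) subset_rfl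
  have h13 := eq_of_braid_of_commute
    (h.braid (i := 1) (j := 3) le_rfl (by omega) (by omega) (by simp [dEdge])) (hc _ _)
  have key := congrArg (PresentedGroup.toGroup fun r hr => (artinRel_swap n).lift_eq_one hr) h13
  change FreeGroup.lift _ _ = FreeGroup.lift _ _ at key
  rw [lift_gen (fun i => Equiv.swap (max 2 i - 1) (max 2 i)) (by omega : 1 ≤ 1) (by omega),
    lift_gen (fun i => Equiv.swap (max 2 i - 1) (max 2 i)) (by omega : 1 ≤ 3) (by omega)] at key
  have := Equiv.congr_fun key 1
  simp at this
  revert this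
  decide

end TwistedTriangle

section BurauMatrices

open Matrix

variable {R : Type*} [CommRing R]

/-- The vector of length `n` with coordinates `W 1, …, W n`. -/
def vec (n : ℕ) (W : ℕ → R) : Fin n → R := fun k => W (k + 1)

/-- The `i`-th standard basis vector of `R ^ n`, numbered from `1`. -/
def stdVec (R : Type*) [CommRing R] (n i : ℕ) : Fin n → R := vec n (Pi.single i 1)

theorem stdVec_dotProduct {n i : ℕ} (hi : 1 ≤ i) (hin : i ≤ n) (W : ℕ → R) :
    stdVec R n i ⬝ᵥ vec n W = W i := by
  obtain ⟨j, rfl⟩ : ∃ j, i = j + 1 := ⟨i - 1, by omega⟩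
  rw [dotProduct, Finset.sum_eq_single ⟨j, hin⟩]
  · simp [stdVec, vec]
  · intro k _ hk
    have : (k : ℕ) + 1 ≠ j + 1 := fun h => hk (Fin.ext (by simpa using h))
    simp [stdVec, vec, Pi.single_eq_of_ne this]
  · simp

theorem stdVec_eq_zero {n i : ℕ} (h : ¬ (1 ≤ i ∧ i ≤ n)) : stdVec R n i = 0 := by
  funext k
  have : (k : ℕ) + 1 ≠ i := by have := k.isLt; omega
  simp [stdVec, vec, Pi.single_eq_of_ne this]

/-- The linear forms of the twisted reduced Burau representation of the `n`-cycle. -/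
def coroot (n t : ℕ) (q : Rˣ) (i : ℕ) : Fin n → R :=
  if i = 1 then
    (1 + q : R) • stdVec R n 1 - stdVec R n 2 + (↑q⁻¹ ^ t : R) • stdVec R n n
  else if i = n then
    (q ^ (t + 1) : R) • stdVec R n 1 - (q : R) • stdVec R n (n - 1) + (1 + q : R) • stdVec R n n
  else (1 + q : R) • stdVec R n i - (q : R) • stdVec R n (i - 1) - stdVec R n (i + 1)

variable {n t : ℕ} (q : Rˣ)

theorem coroot_one_dotProduct (hn : 4 ≤ n) (W : ℕ → R) :
    coroot n t q 1 ⬝ᵥ vec n W = (1 + q) * W 1 - W 2 + ↑q⁻¹ ^ t * W n := by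
  simp only [coroot, if_true, add_dotProduct, sub_dotProduct, smul_dotProduct, smul_eq_mul]
  rw [stdVec_dotProduct le_rfl (by omega), stdVec_dotProduct (by omega) (by omega),
    stdVec_dotProduct (by omega) le_rfl]

theorem coroot_last_dotProduct (hn : 4 ≤ n) (W : ℕ → R) :
    coroot n t q n ⬝ᵥ vec n W = q ^ (t + 1) * W 1 - q * W (n - 1) + (1 + q) * W n := by
  simp only [coroot, if_true, if_neg (by omega : n ≠ 1), add_dotProduct, sub_dotProduct,
    smul_dotProduct, smul_eq_mul]
  rw [stdVec_dotProduct le_rfl (by omega), stdVec_dotProduct (by omega) (by omega),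
    stdVec_dotProduct (by omega) le_rfl]

theorem coroot_dotProduct {i : ℕ} (hi : 1 < i) (hin : i < n) (W : ℕ → R) :
    coroot n t q i ⬝ᵥ vec n W = (1 + q) * W i - q * W (i - 1) - W (i + 1) := by
  simp only [coroot, if_neg (by omega : i ≠ n), if_neg (by omega : i ≠ 1), sub_dotProduct,
    smul_dotProduct, smul_eq_mul]
  rw [stdVec_dotProduct (by omega) (by omega), stdVec_dotProduct (by omega) (by omega),
    stdVec_dotProduct (by omega) (by omega)]

theorem coroot_dotProduct_stdVec_self (hn : 4 ≤ n) {i : ℕ} (hi : 1 ≤ i) (hin : i ≤ n) :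
    coroot n t q i ⬝ᵥ stdVec R n i = 1 + q := by
  rw [stdVec]
  rcases (by omega : i = 1 ∨ i = n ∨ (1 < i ∧ i < n)) with rfl | rfl | ⟨h1, h2⟩
  · rw [coroot_one_dotProduct q hn]
    simp [show n ≠ 1 by omega]
  · rw [coroot_last_dotProduct q hn]
    simp [show 1 ≠ i by omega, show i - 1 ≠ i by omega]
  · rw [coroot_dotProduct q h1 h2]
    simp [show i - 1 ≠ i by omega]

theorem coroot_dotProduct_stdVec_succ (hn : 4 ≤ n) {i : ℕ} (hi : 1 ≤ i) (hin : i < n) :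
    coroot n t q i ⬝ᵥ stdVec R n (i + 1) = -1 := by
  rw [stdVec]
  rcases (by omega : i = 1 ∨ (1 < i ∧ i < n)) with rfl | ⟨h1, h2⟩
  · rw [coroot_one_dotProduct q hn]
    simp [show n ≠ 2 by omega]
  · rw [coroot_dotProduct q h1 h2]
    simp [show i - 1 ≠ i + 1 by omega]

theorem coroot_succ_dotProduct_stdVec (hn : 4 ≤ n) {i : ℕ} (hi : 1 ≤ i) (hin : i < n) :
    coroot n t q (i + 1) ⬝ᵥ stdVec R n i = -q := by
  rw [stdVec]
  rcases (by omega : i + 1 = n ∨ i + 1 < n) with rfl | h1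
  · rw [coroot_last_dotProduct q hn]
    simp [show 1 ≠ i by omega]
  · rw [coroot_dotProduct q (by omega) h1]
    simp [show i + 1 + 1 ≠ i by omega]

theorem coroot_one_dotProduct_stdVec_last (hn : 4 ≤ n) :
    coroot n t q 1 ⬝ᵥ stdVec R n n = ↑q⁻¹ ^ t := by
  rw [stdVec, coroot_one_dotProduct q hn]
  simp [show 1 ≠ n by omega, show 2 ≠ n by omega]

theorem coroot_last_dotProduct_stdVec_one (hn : 4 ≤ n) :
    coroot n t q n ⬝ᵥ stdVec R n 1 = q ^ (t + 1) := by
  rw [stdVec, coroot_last_dotProduct q hn]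
  simp [show n ≠ 1 by omega, show n - 1 ≠ 1 by omega]

theorem coroot_dotProduct_stdVec_eq_zero (hn : 4 ≤ n) {i j : ℕ} (hi : 1 ≤ i) (hin : i ≤ n)
    (h1 : i ≠ j) (h2 : i + 1 ≠ j) (h3 : j + 1 ≠ i) (h4 : ¬ (i = 1 ∧ j = n))
    (h5 : ¬ (i = n ∧ j = 1)) : coroot n t q i ⬝ᵥ stdVec R n j = 0 := by
  rw [stdVec]
  rcases (by omega : i = 1 ∨ i = n ∨ (1 < i ∧ i < n)) with rfl | rfl | ⟨h6, h7⟩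
  · rw [coroot_one_dotProduct q hn]
    simp [h1, show 2 ≠ j by omega, show n ≠ j by omega]
  · rw [coroot_last_dotProduct q hn]
    simp [h1, show 1 ≠ j by omega, show i - 1 ≠ j by omega]
  · rw [coroot_dotProduct q h6 h7]
    simp [h1, h2, show i - 1 ≠ j by omega]

variable (n t) in
/-- The rank one matrix subtracted from the identity in the twisted Burau representation. -/
def burauRankOne (i : ℕ) : Matrix (Fin n) (Fin n) R :=
  vecMulVec (stdVec R n i) (coroot n t q i)

theorem burauRankOne_mul_self (hn : 4 ≤ n) (i : ℕ) :
    burauRankOne n t q i * burauRankOne n t q i = (1 + q : R) • burauRankOne n t q i := by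
  by_cases h : 1 ≤ i ∧ i ≤ n
  · rw [burauRankOne, vecMulVec_mul_vecMulVec, coroot_dotProduct_stdVec_self q hn h.1 h.2,
      vecMulVec_smul]
  · simp [burauRankOne, stdVec_eq_zero h]

variable (t) in
/-- The image of the `i`-th generator in the twisted Burau representation. -/
def burauGen (hn : 4 ≤ n) (i : ℕ) : (Matrix (Fin n) (Fin n) R)ˣ where
  val := 1 - burauRankOne n t q i
  inv := 1 - (↑q⁻¹ : R) • burauRankOne n t q i
  val_inv := by
    have h : (↑q⁻¹ : R) * (1 + q) = ↑q⁻¹ + 1 := by rw [mul_add, mul_one, Units.inv_mul]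
    simp only [mul_sub, sub_mul, one_mul, mul_one, mul_smul_comm, burauRankOne_mul_self q hn,
      smul_sub, smul_smul, h]
    rw [add_smul, one_smul]
    abel
  inv_val := by
    have h : (↑q⁻¹ : R) * (1 + q) = ↑q⁻¹ + 1 := by rw [mul_add, mul_one, Units.inv_mul]
    simp only [mul_sub, sub_mul, one_mul, mul_one, smul_mul_assoc, burauRankOne_mul_self q hn,
      smul_smul, h]
    rw [add_smul, one_smul]
    abel

theorem val_burauGen (hn : 4 ≤ n) (i : ℕ) :
    (burauGen t q hn i).val = 1 - burauRankOne n t q i := rfl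

theorem val_inv_burauGen (hn : 4 ≤ n) (i : ℕ) :
    ((burauGen t q hn i)⁻¹).val = 1 - (↑q⁻¹ : R) • burauRankOne n t q i := rfl

theorem one_sub_braid {A : Type*} [Ring A] [Algebra R A] (r : R) {E F : A}
    (hE : E * E = (1 + r) • E) (hF : F * F = (1 + r) • F) (hEF : E * F * E = r • E)
    (hFE : F * E * F = r • F) :
    (1 - E) * (1 - F) * (1 - E) = (1 - F) * (1 - E) * (1 - F) := by
  have h1 : (1 - E) * (1 - F) * (1 - E) =
      1 - E - E - F + E * E + E * F + F * E - E * F * E := by noncomm_ring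
  have h2 : (1 - F) * (1 - E) * (1 - F) =
      1 - F - F - E + F * F + E * F + F * E - F * E * F := by noncomm_ring
  rw [h1, h2, hE, hF, hEF, hFE, add_smul, add_smul, one_smul, one_smul]
  abel

theorem vecMulVec_mul_mul {m : Type*} [Fintype m] (u v w x : m → R) :
    vecMulVec u v * vecMulVec w x * vecMulVec u v =
      ((v ⬝ᵥ w) * (x ⬝ᵥ u)) • vecMulVec u v := by
  rw [vecMulVec_mul_vecMulVec, vecMulVec_smul, smul_mul_assoc, vecMulVec_mul_vecMulVec,
    vecMulVec_smul, smul_smul]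

theorem burauRankOne_braid (hn : 4 ≤ n) {i j : ℕ}
    (h : (coroot n t q i ⬝ᵥ stdVec R n j) * (coroot n t q j ⬝ᵥ stdVec R n i) = q) :
    burauGen t q hn i * burauGen t q hn j * burauGen t q hn i =
      burauGen t q hn j * burauGen t q hn i * burauGen t q hn j := by
  ext1
  refine one_sub_braid (q : R) (burauRankOne_mul_self q hn i) (burauRankOne_mul_self q hn j) ?_ ?_
  · rw [burauRankOne, burauRankOne, vecMulVec_mul_mul, h]
  · rw [burauRankOne, burauRankOne, vecMulVec_mul_mul, mul_comm (_ ⬝ᵥ _), h]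

theorem one_sub_vecMulVec_commute {m : Type*} [Fintype m] [DecidableEq m] {u v w x : m → R}
    (h1 : v ⬝ᵥ w = 0) (h2 : x ⬝ᵥ u = 0) :
    Commute (1 - vecMulVec u v) (1 - vecMulVec w x) := by
  have h : Commute (vecMulVec u v) (vecMulVec w x) := by
    rw [Commute, SemiconjBy, vecMulVec_mul_vecMulVec, vecMulVec_mul_vecMulVec, h1, h2]
    simp
  exact (Commute.one_left _).sub_left ((Commute.one_right _).sub_right h)

theorem artinRel_burauGen (hn : 4 ≤ n) : ArtinRel n (cycEdge n) (burauGen t q hn) where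
  braid {i j} hi hij hj hE := by
    apply burauRankOne_braid
    rcases hE with ⟨-, -, rfl⟩ | ⟨rfl, rfl⟩
    · rw [coroot_dotProduct_stdVec_succ q hn hi hj, coroot_succ_dotProduct_stdVec q hn hi hj]
      ring
    · rw [coroot_one_dotProduct_stdVec_last q hn, coroot_last_dotProduct_stdVec_one q hn,
        pow_succ, ← mul_assoc, ← mul_pow, Units.inv_mul, one_pow, one_mul]
  comm {i j} hi hij hj hE := by
    simp only [cycEdge] at hE
    refine Units.ext ?_
    exact one_sub_vecMulVec_commute
      (coroot_dotProduct_stdVec_eq_zero q hn hi (by omega) (by omega) (by omega) (by omega)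
        (by omega) (by omega))
      (coroot_dotProduct_stdVec_eq_zero q hn (by omega) (by omega) (by omega) (by omega) (by omega)
        (by omega) (by omega))

theorem mulIcc_mulVec {m : Type*} [Fintype m] [DecidableEq m] (y : ℕ → Matrix m m R)
    (S : ℕ → m → R) {a b : ℕ} (h : a ≤ b + 1)
    (hy : ∀ i, a ≤ i → i ≤ b → y i *ᵥ S (i + 1) = S i) : mulIcc y a b *ᵥ S (b + 1) = S a := by
  induction b with
  | zero =>
    rcases (by omega : a = 0 ∨ a = 1) with rfl | rfl
    · rw [mulIcc_self, hy 0 le_rfl le_rfl]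
    · rw [mulIcc_of_lt _ (by omega), one_mulVec]
  | succ b ih =>
    rcases h.lt_or_eq with h | rfl
    · rw [mulIcc_succ _ (by omega), ← mulVec_mulVec, hy _ (by omega) le_rfl]
      exact ih (by omega) fun i h1 h2 => hy i h1 (by omega)
    · rw [mulIcc_of_lt _ (by omega), one_mulVec]

theorem vecMul_mulIcc {m : Type*} [Fintype m] [DecidableEq m] (y : ℕ → Matrix m m R)
    (S : ℕ → m → R) {a b : ℕ} (h : a ≤ b + 1)
    (hy : ∀ i, a ≤ i → i ≤ b → S i ᵥ* y i = S (i + 1)) : S a ᵥ* mulIcc y a b = S (b + 1) := by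
  induction b with
  | zero =>
    rcases (by omega : a = 0 ∨ a = 1) with rfl | rfl
    · rw [mulIcc_self, hy 0 le_rfl le_rfl]
    · rw [mulIcc_of_lt _ (by omega), vecMul_one]
  | succ b ih =>
    rcases h.lt_or_eq with h | rfl
    · rw [mulIcc_succ _ (by omega), ← vecMul_vecMul, ih (by omega) fun i h1 h2 => hy i h1 (by omega),
        hy _ (by omega) le_rfl]
    · rw [mulIcc_of_lt _ (by omega), vecMul_one]

variable (n t) in
/-- The partial sums of rescaled basis vectors swept out by the twisted cycle word. -/
def sweepVec (j : ℕ) : Fin n → R := vec n fun m => if j ≤ m then ↑q⁻¹ ^ (t + 2 - m) else 0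

variable (n t) in
/-- The partial sums of rescaled linear forms swept out by the twisted cycle word. -/
def sweepForm (j : ℕ) : Fin n → R :=
  ∑ i ∈ Finset.Icc j n, (q ^ (t + 2 - i) : R) • coroot n t q i

theorem sweepVec_eq (j : ℕ) : sweepVec n t q j =
    sweepVec n t q (j + 1) + (↑q⁻¹ ^ (t + 2 - j) : R) • stdVec R n j := by
  funext k
  simp only [sweepVec, vec, stdVec, Pi.add_apply, Pi.smul_apply, smul_eq_mul, Pi.single_apply]
  rcases lt_trichotomy ((k : ℕ) + 1) j with h | h | h
  · simp [show ¬ j ≤ (k : ℕ) + 1 by omega, show ¬ j ≤ (k : ℕ) by omega, h.ne]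
  · simp [h]
  · simp [show j ≤ (k : ℕ) + 1 by omega, show j ≤ (k : ℕ) by omega, h.ne']

theorem sweepForm_eq {j : ℕ} (hj : j ≤ n) : sweepForm n t q j =
    sweepForm n t q (j + 1) + (q ^ (t + 2 - j) : R) • coroot n t q j := by
  rw [sweepForm, ← Finset.insert_Icc_succ_left_eq_Icc hj, Finset.sum_insert (by simp), add_comm]
  rfl

theorem sweepVec_last (hn : 4 ≤ n) (ht : t ≤ n - 3) : sweepVec n t q n = stdVec R n n := by
  rw [sweepVec_eq, Nat.sub_eq_zero_of_le (by omega), pow_zero, one_smul, add_eq_right]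
  funext k
  have := k.isLt
  simp [sweepVec, vec, show ¬ n ≤ (k : ℕ) by omega]

theorem sweepForm_last (hn : 4 ≤ n) (ht : t ≤ n - 3) : sweepForm n t q n = coroot n t q n := by
  rw [sweepForm, Finset.Icc_self, Finset.sum_singleton, Nat.sub_eq_zero_of_le (by omega), pow_zero,
    one_smul]

theorem coroot_dotProduct_sweepVec {j : ℕ} (hj : 1 < j) (hjn : j < n) :
    coroot n t q j ⬝ᵥ sweepVec n t q (j + 1) = -(↑q⁻¹ ^ (t + 2 - (j + 1))) := by
  rw [sweepVec, coroot_dotProduct q hj hjn]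
  simp [show ¬ j + 1 ≤ j - 1 by omega]

theorem sweepForm_dotProduct_stdVec_eq_zero (hn : 4 ≤ n) {j k : ℕ} (hj : 1 < j) (hjk : j + 2 ≤ k) :
    sweepForm n t q k ⬝ᵥ stdVec R n j = 0 := by
  rw [sweepForm, sum_dotProduct]
  refine Finset.sum_eq_zero fun i hi => ?_
  have := Finset.mem_Icc.1 hi
  rw [smul_dotProduct, coroot_dotProduct_stdVec_eq_zero q hn (by omega) (by omega) (by omega)
    (by omega) (by omega) (by omega) (by omega), smul_zero]

theorem sweepForm_dotProduct_stdVec (hn : 4 ≤ n) {j : ℕ} (hj : 1 < j) (hjn : j < n) :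
    sweepForm n t q j ⬝ᵥ stdVec R n j =
      q ^ (t + 2 - j) * (1 + q) - q ^ (t + 2 - (j + 1)) * q := by
  rw [sweepForm_eq q hjn.le, sweepForm_eq q hjn, add_dotProduct, add_dotProduct, smul_dotProduct,
    smul_dotProduct, sweepForm_dotProduct_stdVec_eq_zero q hn hj le_rfl,
    coroot_succ_dotProduct_stdVec q hn hj.le hjn,
    coroot_dotProduct_stdVec_self q hn hj.le hjn.le, smul_eq_mul, smul_eq_mul]
  ring

theorem burauRankOne_mulVec_sweepVec {j : ℕ} (hj : 1 < j) (hjn : j < n) :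
    burauRankOne n t q j *ᵥ sweepVec n t q (j + 1) =
      -((↑q⁻¹ ^ (t + 2 - (j + 1)) : R) • stdVec R n j) := by
  rw [burauRankOne, vecMulVec_mulVec, coroot_dotProduct_sweepVec q hj hjn, op_smul_eq_smul,
    neg_smul]

theorem sweepForm_vecMul_burauRankOne (hn : 4 ≤ n) {j : ℕ} (hj : 1 < j) (hjn : j < n) :
    sweepForm n t q j ᵥ* burauRankOne n t q j =
      (q ^ (t + 2 - j) * (1 + q) - q ^ (t + 2 - (j + 1)) * q : R) • coroot n t q j := by
  rw [burauRankOne, vecMul_vecMulVec, sweepForm_dotProduct_stdVec q hn hj hjn]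

theorem burauGen_mulVec_sweepVec (hn : 4 ≤ n) {j : ℕ} (hj : t + 2 ≤ j) (hjn : j < n) :
    (burauGen t q hn j).val *ᵥ sweepVec n t q (j + 1) = sweepVec n t q j := by
  rw [val_burauGen, sub_mulVec, one_mulVec, burauRankOne_mulVec_sweepVec q (by omega) hjn,
    sweepVec_eq q j, Nat.sub_eq_zero_of_le hj, Nat.sub_eq_zero_of_le (by omega), sub_neg_eq_add]

theorem burauGen_inv_mulVec_sweepVec (hn : 4 ≤ n) {j : ℕ} (hj : 1 < j) (hjt : j ≤ t + 1)
    (hjn : j < n) :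
    ((burauGen t q hn j)⁻¹).val *ᵥ sweepVec n t q (j + 1) = sweepVec n t q j := by
  rw [val_inv_burauGen, sub_mulVec, one_mulVec, smul_mulVec,
    burauRankOne_mulVec_sweepVec q hj hjn, sweepVec_eq q j,
    show t + 2 - j = t + 2 - (j + 1) + 1 by omega, pow_succ', smul_neg, sub_neg_eq_add, smul_smul]

theorem sweepForm_vecMul_burauGen (hn : 4 ≤ n) {j : ℕ} (hj : t + 2 ≤ j) (hjn : j < n) :
    sweepForm n t q j ᵥ* (burauGen t q hn j).val = sweepForm n t q (j + 1) := by
  rw [val_burauGen, vecMul_sub, vecMul_one, sweepForm_vecMul_burauRankOne q hn (by omega) hjn,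
    sweepForm_eq q hjn.le, Nat.sub_eq_zero_of_le hj, Nat.sub_eq_zero_of_le (by omega)]
  simp

theorem sweepForm_vecMul_burauGen_inv (hn : 4 ≤ n) {j : ℕ} (hj : 1 < j) (hjt : j ≤ t + 1)
    (hjn : j < n) :
    sweepForm n t q j ᵥ* ((burauGen t q hn j)⁻¹).val = sweepForm n t q (j + 1) := by
  rw [val_inv_burauGen, vecMul_sub, vecMul_one, vecMul_smul,
    sweepForm_vecMul_burauRankOne q hn hj hjn, sweepForm_eq q hjn.le,
    show t + 2 - j = t + 2 - (j + 1) + 1 by omega, smul_smul]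
  have : (↑q⁻¹ : R) * (q ^ (t + 2 - (j + 1) + 1) * (1 + q) - q ^ (t + 2 - (j + 1)) * q) =
      q ^ (t + 2 - (j + 1) + 1) := by
    linear_combination (q ^ (t + 2 - (j + 1) + 1) : R) * q.inv_mul
  rw [this, add_sub_cancel_right]

theorem tc_burauGen (hn : 4 ≤ n) (ht1 : 1 ≤ t) (ht : t ≤ n - 3) :
    tc (burauGen t q hn) n t = 1 := by
  rw [tc_eq_one_iff]
  set A := mulIcc (fun i => (burauGen t q hn i)⁻¹) 2 (t + 1)
  set B := mulIcc (burauGen t q hn) (t + 2) (n - 1)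
  have hA' : A.val = mulIcc (fun i => ((burauGen t q hn i)⁻¹).val) 2 (t + 1) :=
    map_mulIcc (Units.coeHom _) _ _ _
  have hB' : B.val = mulIcc (fun i => (burauGen t q hn i).val) (t + 2) (n - 1) :=
    map_mulIcc (Units.coeHom _) _ _ _
  have hv : (A * B).val *ᵥ stdVec R n n = sweepVec n t q 2 := by
    have h1 := mulIcc_mulVec (fun i => (burauGen t q hn i).val) (sweepVec n t q)
      (a := t + 2) (b := n - 1) (by omega)
      fun i h1 h2 => burauGen_mulVec_sweepVec q hn h1 (by omega)
    have h2 := mulIcc_mulVec (fun i => ((burauGen t q hn i)⁻¹).val) (sweepVec n t q)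
      (a := 2) (b := t + 1) (by omega)
      fun i h1 h2 => burauGen_inv_mulVec_sweepVec q hn h1 h2 (by omega)
    rw [Nat.sub_add_cancel (by omega), sweepVec_last q hn ht] at h1
    rw [Units.val_mul, ← mulVec_mulVec, hA', hB', h1, h2]
  have hf : sweepForm n t q 2 ᵥ* (A * B).val = coroot n t q n := by
    have h1 := vecMul_mulIcc (fun i => (burauGen t q hn i).val) (sweepForm n t q)
      (a := t + 2) (b := n - 1) (by omega)
      fun i h1 h2 => sweepForm_vecMul_burauGen q hn h1 (by omega)
    have h2 := vecMul_mulIcc (fun i => ((burauGen t q hn i)⁻¹).val) (sweepForm n t q)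
      (a := 2) (b := t + 1) (by omega)
      fun i h1 h2 => sweepForm_vecMul_burauGen_inv q hn h1 h2 (by omega)
    rw [Nat.sub_add_cancel (by omega), sweepForm_last q hn ht] at h1
    rw [Units.val_mul, ← vecMul_vecMul, hA', hB', h2, h1]
  have hconj : (A * (B * burauGen t q hn n * B⁻¹) * A⁻¹).val =
      1 - vecMulVec (sweepVec n t q 2) (sweepForm n t q 2) := by
    have h1 : A * (B * burauGen t q hn n * B⁻¹) * A⁻¹ = A * B * burauGen t q hn n * (A * B)⁻¹ := by
      group
    rw [h1, Units.val_mul, Units.mul_inv_eq_iff_eq_mul, Units.val_mul, val_burauGen, burauRankOne,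
      mul_sub, sub_mul, mul_vecMulVec, vecMulVec_mul, hv, hf, mul_one, one_mul]
  refine Units.ext ?_
  rw [Units.val_mul (burauGen t q hn 1), Units.val_mul _ (burauGen t q hn 1), hconj]
  refine one_sub_vecMulVec_commute ?_ ?_
  · rw [sweepVec, coroot_one_dotProduct q hn]
    simp [show 2 ≤ n by omega, show t + 2 - n = 0 by omega]
  · have h0 : sweepForm n t q 2 = ∑ i ∈ Finset.Icc 2 n, (q ^ (t + 2 - i) : R) • coroot n t q i := rfl
    rw [h0, sum_dotProduct, Finset.sum_eq_add_of_mem 2 n (by simp; omega) (by simp; omega)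
      (by omega)]
    · rw [smul_dotProduct, smul_dotProduct, coroot_last_dotProduct_stdVec_one q hn,
        coroot_succ_dotProduct_stdVec q hn (i := 1) le_rfl (by omega),
        show t + 2 - n = 0 by omega]
      simp [pow_succ]
    · intro i hi h
      obtain ⟨hi2, hin⟩ := Finset.mem_Icc.1 hi
      rw [smul_dotProduct, coroot_dotProduct_stdVec_eq_zero q hn (by omega) hin (by omega)
        (by omega) (by omega) (by omega) (by omega), smul_zero]

end BurauMatrices

section BurauRepresentation

open Matrix

variable {R : Type*} [CommRing R] {n t : ℕ} (q : Rˣ)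

theorem tc_congr {G : Type*} [Group G] {y y' : ℕ → G} (hn : 4 ≤ n) (ht : t ≤ n - 3)
    (h : ∀ i, 1 ≤ i → i ≤ n → y i = y' i) : tc y n t = tc y' n t := by
  rw [tc, tc, h 1 le_rfl (by omega), h n (by omega) le_rfl,
    mulIcc_congr (y := y) (y' := y') fun i h1 h2 => h i (by omega) (by omega),
    mulIcc_congr (y := fun i => (y i)⁻¹) (y' := fun i => (y' i)⁻¹)
      fun i h1 h2 => by rw [h i (by omega) (by omega)]]

/-- The twisted Burau representation of `G_{n,t}`. -/
def burau (hn : 4 ≤ n) (ht1 : 1 ≤ t) (ht : t ≤ n - 3) :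
    Gnt n t →* (Matrix (Fin n) (Fin n) R)ˣ :=
  PresentedGroup.toGroup (f := fun k : Fin n => burauGen t q hn (k + 1)) <| by
    rintro r (hr | rfl)
    · exact (artinRel_burauGen q hn).lift_eq_one hr
    · rw [map_tc, tc_congr hn ht fun i h1 h2 => lift_gen (burauGen t q hn) h1 h2]
      exact tc_burauGen q hn ht1 ht

theorem burau_mk_gen (hn : 4 ≤ n) (ht1 : 1 ≤ t) (ht : t ≤ n - 3) {i : ℕ} (h1 : 1 ≤ i)
    (h2 : i ≤ n) :
    burau q hn ht1 ht (PresentedGroup.mk _ (gen n i)) = burauGen t q hn i :=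
  lift_gen (burauGen t q hn) h1 h2

theorem det_burauGen (hn : 4 ≤ n) {i : ℕ} (h1 : 1 ≤ i) (h2 : i ≤ n) :
    (burauGen t q hn i).val.det = -q := by
  rw [val_burauGen, burauRankOne, sub_eq_add_neg, ← neg_vecMulVec, vecMulVec_eq Unit,
    det_one_add_replicateCol_mul_replicateRow, dotProduct_neg,
    coroot_dotProduct_stdVec_self q hn h1 h2]
  ring

theorem mulVec_stdVec_of_commute {i : ℕ} {c : R} {w : Fin n → R}
    {M : Matrix (Fin n) (Fin n) R} (hM : Commute M (burauRankOne n t q i))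
    (hc : c * (coroot n t q i ⬝ᵥ w) = 1) :
    M *ᵥ stdVec R n i = (c * (coroot n t q i ⬝ᵥ M *ᵥ w)) • stdVec R n i := by
  have h := congrArg (c • · *ᵥ w) hM.eq
  simp only [burauRankOne, ← mulVec_mulVec, vecMulVec_mulVec, op_smul_eq_smul, mulVec_smul,
    smul_smul, hc, one_smul] at h
  exact h

theorem eq_scalar_of_commute (hn : 4 ≤ n) {M : Matrix (Fin n) (Fin n) R}
    (hM : ∀ i, 1 ≤ i → i ≤ n → Commute M (burauRankOne n t q i)) :
    ∃ c : R, M = c • (1 : Matrix (Fin n) (Fin n) R) := by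
  have hdiag : ∀ i, 1 ≤ i → i ≤ n → ∃ c : R, M *ᵥ stdVec R n i = c • stdVec R n i := by
    intro i h1 h2
    rcases h2.lt_or_eq with h2 | rfl
    · exact ⟨_, mulVec_stdVec_of_commute q (c := -1) (w := stdVec R n (i + 1)) (hM i h1 h2.le)
        (by rw [coroot_dotProduct_stdVec_succ q hn h1 h2]; ring)⟩
    · exact ⟨_, mulVec_stdVec_of_commute q (c := ↑q⁻¹ ^ (t + 1)) (w := stdVec R i 1)
        (hM i h1 le_rfl) (by rw [coroot_last_dotProduct_stdVec_one q hn, ← mul_pow,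
          Units.inv_mul, one_pow])⟩
  obtain ⟨c, hc⟩ := hdiag n (by omega) le_rfl
  have hall : ∀ k, k < n → M *ᵥ stdVec R n (n - k) = c • stdVec R n (n - k) := by
    intro k hk
    induction k with
    | zero => exact hc
    | succ k ih =>
      have h := mulVec_stdVec_of_commute q (c := -1) (w := stdVec R n (n - (k + 1) + 1))
        (hM (n - (k + 1)) (by omega) (by omega))
        (by rw [coroot_dotProduct_stdVec_succ q hn (by omega) (by omega)]; ring)
      rw [show n - (k + 1) + 1 = n - k by omega, ih (by omega), dotProduct_smul,
        show n - k = n - (k + 1) + 1 by omega,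
        coroot_dotProduct_stdVec_succ q hn (by omega) (by omega)] at h
      simpa using h
  refine ⟨c, ?_⟩
  ext i j
  have h := congrFun (hall (n - (j + 1)) (by omega)) i
  rw [show n - (n - (j + 1)) = (j : ℕ) + 1 by omega] at h
  have hs : stdVec R n (j + 1) = Pi.single j 1 := by
    funext k
    simp [stdVec, vec, Pi.single_apply, Fin.ext_iff]
  rw [hs, mulVec_single_one] at h
  simpa [Pi.single_apply, one_apply] using h

theorem burau_central (hn : 4 ≤ n) (ht1 : 1 ≤ t) (ht : t ≤ n - 3) {g : Gnt n t}
    (hg : ∀ h, Commute g h) :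
    ∃ c : R, (burau q hn ht1 ht g).val = c • (1 : Matrix (Fin n) (Fin n) R) := by
  refine eq_scalar_of_commute (t := t) q hn fun i h1 h2 => ?_
  have h := (hg (PresentedGroup.mk _ (gen n i))).map (burau q hn ht1 ht)
  rw [burau_mk_gen q hn ht1 ht h1 h2] at h
  have h3 := (Commute.one_right _).sub_right (h.map (Units.coeHom _))
  simpa [val_burauGen] using h3

theorem exists_coroot_dotProduct_eq_zero [Nontrivial R] (hn : 4 ≤ n) (ht : t ≤ n - 3)
    (hq : (q : R) ^ (t + 1) = -1 ∨ (q : R) ^ (n - t - 1) = -1) :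
    ∃ v : Fin n → R, v ≠ 0 ∧ ∀ i, 1 ≤ i → i ≤ n → coroot n t q i ⬝ᵥ v = 0 := by
  have hne : ∀ W : ℕ → R, IsUnit (W 1) → vec n W ≠ 0 := fun W h1 h0 =>
    h1.ne_zero (congrFun h0 ⟨0, by omega⟩)
  rcases hq with hq | hq
  · refine ⟨vec n fun _ => 1, hne _ isUnit_one, fun i h1 h2 => ?_⟩
    rcases (by omega : i = 1 ∨ i = n ∨ (1 < i ∧ i < n)) with rfl | rfl | ⟨h3, h4⟩
    · rw [coroot_one_dotProduct q hn]
      have : (↑q⁻¹ : R) ^ t * q ^ t = 1 := by rw [← mul_pow, Units.inv_mul, one_pow]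
      rw [pow_succ] at hq
      linear_combination (↑q⁻¹ : R) ^ t * hq - q * this
    · rw [coroot_last_dotProduct q hn, hq]
      ring
    · rw [coroot_dotProduct q h3 h4]
      ring
  · refine ⟨vec n fun i => q ^ i, hne _ (by simp), fun i h1 h2 => ?_⟩
    rcases (by omega : i = 1 ∨ i = n ∨ (1 < i ∧ i < n)) with rfl | rfl | ⟨h3, h4⟩
    · rw [coroot_one_dotProduct q hn]
      have : (↑q⁻¹ : R) ^ t * q ^ t = 1 := by rw [← mul_pow, Units.inv_mul, one_pow]
      have hsplit : (q : R) ^ n = q ^ (n - t - 1) * q ^ t * q := by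
        rw [← pow_add, ← pow_succ]
        congr 1
        omega
      rw [hsplit, hq]
      linear_combination -(q : R) * this
    · rw [coroot_last_dotProduct q hn]
      have hsplit : (q : R) ^ i = q ^ (i - t - 1) * q ^ t * q := by
        rw [← pow_add, ← pow_succ]
        congr 1
        omega
      rw [mul_comm (q : R) (q ^ (i - 1)), ← pow_succ, Nat.sub_add_cancel h1, hsplit, hq]
      ring
    · obtain ⟨j, rfl⟩ : ∃ j, i = j + 1 := ⟨i - 1, by omega⟩
      rw [coroot_dotProduct q h3 h4, Nat.add_sub_cancel]
      ring

theorem burau_mulVec_eq_self (hn : 4 ≤ n) (ht1 : 1 ≤ t) (ht : t ≤ n - 3) {v : Fin n → R}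
    (hv : ∀ i, 1 ≤ i → i ≤ n → coroot n t q i ⬝ᵥ v = 0) (g : Gnt n t) :
    (burau q hn ht1 ht g).val *ᵥ v = v := by
  let K : Subgroup (Gnt n t) :=
    { carrier := {g | (burau q hn ht1 ht g).val *ᵥ v = v}
      one_mem' := by simp
      mul_mem' := fun {a b} ha hb => by
        simp only [Set.mem_ofPred_eq] at ha hb ⊢
        rw [map_mul, Units.val_mul, ← mulVec_mulVec, hb, ha]
      inv_mem' := fun {a} ha => by
        simp only [Set.mem_ofPred_eq] at ha ⊢
        conv_lhs => rw [← ha]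
        rw [mulVec_mulVec, ← Units.val_mul, ← map_mul, inv_mul_cancel, map_one, Units.val_one,
          one_mulVec] }
  refine mk_gen_induction K (fun i h1 h2 => ?_) g
  change (burau q hn ht1 ht (PresentedGroup.mk _ (gen n i))).val *ᵥ v = v
  rw [burau_mk_gen q hn ht1 ht h1 h2, val_burauGen, burauRankOne, sub_mulVec, one_mulVec,
    vecMulVec_mulVec, hv i h1 h2]
  simp

theorem map_burau {S : Type*} [CommRing S] (φ : R →+* S) (hn : 4 ≤ n) (ht1 : 1 ≤ t)
    (ht : t ≤ n - 3) (g : Gnt n t) :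
    (burau q hn ht1 ht g).val.map φ = (burau (Units.map (φ : R →* S) q) hn ht1 ht g).val := by
  have hstd : ∀ i k, φ (stdVec R n i k) = stdVec S n i k := fun i k => by
    simp [stdVec, vec, Pi.single_apply, apply_ite φ]
  have hroot : ∀ i k, φ (coroot n t q i k) = coroot n t (Units.map (φ : R →* S) q) i k :=
    fun i k => by
      unfold coroot
      split_ifs <;> simp [hstd]
  have hhom : (Units.map (φ.mapMatrix (m := Fin n) : _ →* _)).comp (burau q hn ht1 ht) =
      burau (Units.map (φ : R →* S) q) hn ht1 ht := by
    refine PresentedGroup.ext fun k => Units.ext ?_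
    have h1 := burau_mk_gen q hn ht1 ht (i := k + 1) (by omega) k.isLt
    have h2 := burau_mk_gen (Units.map (φ : R →* S) q) hn ht1 ht (i := k + 1) (by omega) k.isLt
    rw [gen_eq_of] at h1 h2
    change ((burau q hn ht1 ht (PresentedGroup.mk _ (FreeGroup.of k))).val).map φ =
      (burau _ hn ht1 ht (PresentedGroup.mk _ (FreeGroup.of k))).val
    rw [h1, h2, val_burauGen, val_burauGen]
    ext i j
    simp [burauRankOne, vecMulVec_apply, hstd, hroot, one_apply, apply_ite φ]
  exact congrArg Units.val (DFunLike.congr_fun hhom g)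

end BurauRepresentation

section TypeD

theorem ArtinRel.eq_of_comm {A : Type*} [CommGroup A] {n : ℕ} {x : ℕ → A}
    (h : ArtinRel n (dEdge n) x) (hn : 4 ≤ n) {i : ℕ} (h1 : 1 ≤ i) (h2 : i ≤ n) : x i = x 1 := by
  have hE : ∀ i j, 1 ≤ i → i < j → j ≤ n → dEdge n i j → x i = x j := fun i j h1 h2 h3 hE =>
    eq_of_braid_of_commute (h.braid h1 h2 h3 hE) (Commute.all _ _)
  have h13 := hE 1 3 le_rfl (by omega) (by omega) (by simp [dEdge])
  have h23 := hE 2 3 (by omega) (by omega) (by omega) (by simp [dEdge])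
  rcases (by omega : i = 1 ∨ i = 2 ∨ 3 ≤ i) with rfl | rfl | h3
  · rfl
  · rw [h23, h13]
  · induction i, h3 using Nat.le_induction with
    | base => exact h13.symm
    | succ i h3 ih =>
      rw [← hE i (i + 1) (by omega) (by omega) h2 (Or.inr (Or.inr ⟨h3, h2, rfl⟩)),
        ih (by omega) (by omega)]

theorem ArtinD_map_comm {A : Type*} [CommGroup A] {n : ℕ} (hn : 4 ≤ n) (ψ : ArtinD n →* A) :
    ∃ u : A, (∀ g, ψ g ∈ Subgroup.zpowers u) ∧
      ψ (coxeterD (fun i => PresentedGroup.mk _ (gen n i)) n) = u ^ n := by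
  have h := artinRel_mk (n := n) (E := dEdge n) (rels := dRels n) subset_rfl
  have hψ : ArtinRel n (dEdge n) fun i => ψ (PresentedGroup.mk (dRels n) (gen n i)) :=
    { braid := fun h1 h2 h3 hE => by
        simpa only [map_mul] using congrArg ψ (h.braid h1 h2 h3 hE)
      comm := fun _ _ _ _ => Commute.all _ _ }
  have hu : ∀ i, 1 ≤ i → i ≤ n → ψ (PresentedGroup.mk (dRels n) (gen n i)) = _ :=
    fun i h1 h2 => hψ.eq_of_comm hn h1 h2
  refine ⟨ψ (PresentedGroup.mk _ (gen n 1)), fun g => ?_, ?_⟩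
  · refine mk_gen_induction ((Subgroup.zpowers _).comap ψ) (fun i h1 h2 => ?_) g
    rw [Subgroup.mem_comap, hu i h1 h2]
    exact Subgroup.mem_zpowers _
  · rw [coxeterD, map_mul, map_mul, map_mulIcc, hu 2 (by omega) (by omega),
      mulIcc_congr fun i h1 h2 => hu i (by omega) h2]
    simp only [mulIcc, List.map_const', List.prod_replicate, List.length_range]
    rw [← pow_two, ← pow_add]
    congr 1
    omega

theorem ArtinD_central {n : ℕ} {z : ArtinD n}
    (hz : ∀ i, 1 ≤ i → i ≤ n → Commute z (PresentedGroup.mk _ (gen n i))) (g : ArtinD n) :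
    Commute z g := by
  refine (Subgroup.mem_centralizer_singleton_iff.1 (mk_gen_induction
    (Subgroup.centralizer {z}) (fun i h1 h2 => ?_) g)).symm
  exact Subgroup.mem_centralizer_singleton_iff.2 (hz i h1 h2).symm.eq

end TypeD

section LaurentUnits

open LaurentPolynomial

theorem laurent_sq_eq_one_of_pow_eq_one {x : LaurentPolynomial ℤ} {m : ℕ} (hm : m ≠ 0)
    (hx : x ^ m = 1) : x ^ 2 = 1 := by
  obtain ⟨N, p, hp⟩ := x.exists_T_pow
  have hp' : Polynomial.toLaurent p =
      x * Polynomial.toLaurent (Polynomial.X ^ N : Polynomial ℤ) := by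
    rw [hp, Polynomial.toLaurent_X_pow]
  have hpm : p ^ m = (Polynomial.X ^ N) ^ m := by
    apply Polynomial.toLaurent_injective
    rw [map_pow, hp', mul_pow, hx, one_mul, map_pow _ (Polynomial.X ^ N)]
  have hdvd : p ∣ Polynomial.X ^ (N * m) := by
    rw [pow_mul, ← hpm]
    exact dvd_pow_self p hm
  obtain ⟨i, -, c, hc⟩ := (dvd_prime_pow Polynomial.prime_X _).1 hdvd
  have hc2 : (c : Polynomial ℤ) ^ 2 = 1 := by
    obtain ⟨r, hr, hrc⟩ := Polynomial.isUnit_iff.1 c.isUnit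
    rcases Int.isUnit_iff.1 hr with rfl | rfl <;> simp [← hrc]
  have hp2 : p ^ 2 = (Polynomial.X ^ i) ^ 2 := by rw [← hc, mul_pow, hc2, mul_one]
  have hi : i = N := by
    have h1 : ((Polynomial.X : Polynomial ℤ) ^ (i * 2 * m)) = Polynomial.X ^ (N * m * 2) := by
      rw [pow_mul, pow_mul, ← hp2, ← pow_mul, mul_comm 2 m, pow_mul, hpm, ← pow_mul, ← pow_mul,
        mul_assoc]
    have h2 := congrArg Polynomial.natDegree h1
    rw [Polynomial.natDegree_X_pow, Polynomial.natDegree_X_pow] at h2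
    have h3 : i * (2 * m) = N * (2 * m) := by linarith
    exact Nat.eq_of_mul_eq_mul_right (by omega) h3
  have hfin : x ^ 2 * T (N * 2) = T (N * 2) := by
    have h := congrArg Polynomial.toLaurent hp2
    rw [map_pow, hp', hi, mul_pow, ← map_pow, ← pow_mul, Polynomial.toLaurent_X_pow] at h
    exact_mod_cast h
  exact (isUnit_T _).mul_right_cancel (hfin.trans (one_mul _).symm)

theorem laurent_sq_eq_sq_of_pow_eq_pow {c : LaurentPolynomial ℤ} {w : (LaurentPolynomial ℤ)ˣ}
    {m : ℕ} (hm : m ≠ 0) (h : c ^ m = w ^ m) : c ^ 2 = w ^ 2 := by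
  have h1 : (c * ↑w⁻¹) ^ m = 1 := by rw [mul_pow, h, ← mul_pow, Units.mul_inv, one_pow]
  have h2 := laurent_sq_eq_one_of_pow_eq_one hm h1
  calc c ^ 2 = (c * ↑w⁻¹) ^ 2 * (w : LaurentPolynomial ℤ) ^ 2 := by
        rw [← mul_pow, Units.inv_mul_cancel_right]
    _ = (w : LaurentPolynomial ℤ) ^ 2 := by rw [h2, one_mul]

theorem laurent_eq_of_odd_pow_eq_pow {c : LaurentPolynomial ℤ} {w : (LaurentPolynomial ℤ)ˣ}
    {m : ℕ} (hm : Odd m) (h : c ^ m = w ^ m) : c = w := by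
  have h2 := laurent_sq_eq_sq_of_pow_eq_pow hm.pos.ne' h
  obtain ⟨k, rfl⟩ := hm
  rw [pow_succ, pow_succ, pow_mul, pow_mul, h2, ← pow_mul] at h
  exact (w.isUnit.pow _).mul_left_cancel h

end LaurentUnits

section Main

open Matrix LaurentPolynomial

theorem exists_isPrimitiveRoot_radical {n t : ℕ} (hn : 4 ≤ n) (ht1 : 1 ≤ t) (ht : t ≤ n - 3) :
    ∃ w : ℂˣ, (∃ v : Fin n → ℂ, v ≠ 0 ∧ ∀ i, 1 ≤ i → i ≤ n → coroot n t w i ⬝ᵥ v = 0) ∧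
      (w : ℂ) ^ (2 * (n - 1)) ≠ 1 := by
  obtain ⟨a, ha, h1, h2⟩ : ∃ a, (a = t + 1 ∨ a = n - t - 1) ∧ n ≤ 2 * a ∧ a < n - 1 := by
    rcases le_total (t + 1) (n - t - 1) with h | h
    · exact ⟨_, Or.inr rfl, by omega, by omega⟩
    · exact ⟨_, Or.inl rfl, by omega, by omega⟩
  have hζ := Complex.isPrimitiveRoot_exp (2 * a) (by omega)
  set ζ := Complex.exp (2 * Real.pi * Complex.I / ((2 * a : ℕ) : ℂ))
  have hζa : ζ ^ a = -1 := by
    have hsq : (ζ ^ a) ^ 2 = 1 ^ 2 := by rw [← pow_mul, mul_comm, hζ.pow_eq_one, one_pow]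
    refine (sq_eq_sq_iff_eq_or_eq_neg.1 hsq).resolve_left fun h => ?_
    have := Nat.le_of_dvd (by omega) ((hζ.pow_eq_one_iff_dvd a).1 h)
    omega
  refine ⟨Units.mk0 ζ (hζ.ne_zero (by omega)), exists_coroot_dotProduct_eq_zero _ hn ht ?_, ?_⟩
  · rcases ha with rfl | rfl
    · exact Or.inl hζa
    · exact Or.inr hζa
  · intro h
    obtain ⟨k, hk⟩ := (Nat.mul_dvd_mul_iff_left (by omega)).1 ((hζ.pow_eq_one_iff_dvd _).1 h)
    rcases (by omega : k = 0 ∨ k = 1 ∨ 2 ≤ k) with rfl | rfl | hk2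
    · omega
    · omega
    · have := Nat.mul_le_mul_left a hk2
      omega

theorem burau_coxeterD {n t : ℕ} (hn : 4 ≤ n) (ht1 : 1 ≤ t) (ht : t ≤ n - 3)
    (q : (LaurentPolynomial ℤ)ˣ) (e : Gnt n t ≃* ArtinD n) {u : (LaurentPolynomial ℤ)ˣ}
    (hu : Units.map detMonoidHom (burau q hn ht1 ht
      (e.symm (coxeterD (fun i => PresentedGroup.mk _ (gen n i)) n))) = u ^ n) :
    (burau q hn ht1 ht (e.symm (coxeterD (fun i => PresentedGroup.mk _ (gen n i)) n ^
      ((n - 1) * 2)))).val = ((u ^ ((n - 1) * 2) : (LaurentPolynomial ℤ)ˣ) : LaurentPolynomial ℤ) •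
        (1 : Matrix (Fin n) (Fin n) (LaurentPolynomial ℤ)) := by
  have h := artinRel_mk (n := n) (E := dEdge n) (rels := dRels n) subset_rfl
  set δ := coxeterD (fun i => PresentedGroup.mk (dRels n) (gen n i)) n
  have hscalar : ∀ m, (∀ g, Commute (δ ^ m) g) → ∃ c : LaurentPolynomial ℤ,
      (burau q hn ht1 ht (e.symm (δ ^ m))).val = c • (1 : Matrix (Fin n) (Fin n) _) ∧
        c ^ n = ((u ^ m : (LaurentPolynomial ℤ)ˣ) : LaurentPolynomial ℤ) ^ n := by
    intro m hm
    obtain ⟨c, hc⟩ := burau_central q hn ht1 ht (g := e.symm (δ ^ m)) fun g => by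
      simpa using (hm (e g)).map e.symm
    refine ⟨c, hc, ?_⟩
    have hdet := congrArg det hc
    rw [det_smul, det_one, mul_one, Fintype.card_fin] at hdet
    rw [← hdet, ← Units.val_pow_eq_pow_val, ← pow_mul, mul_comm, pow_mul, ← hu, ← map_pow,
      ← map_pow, ← map_pow]
    rfl
  rcases Nat.even_or_odd n with he | ho
  · obtain ⟨c, hc, hcn⟩ := hscalar (n - 1) (ArtinD_central fun i h1 h2 =>
      h.coxeterD_pow_commute_of_even hn he h1 h2)
    rw [pow_mul, map_pow, map_pow, Units.val_pow_eq_pow_val, hc, smul_pow, one_pow,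
      laurent_sq_eq_sq_of_pow_eq_pow (by omega) hcn, pow_mul, Units.val_pow_eq_pow_val (u ^ (n - 1))]
  · obtain ⟨c, hc, hcn⟩ := hscalar ((n - 1) * 2) (ArtinD_central fun i h1 h2 =>
      h.coxeterD_pow_commute hn h1 h2)
    rw [hc, laurent_eq_of_odd_pow_eq_pow ho hcn]

theorem Gnt_not_isom_ArtinD {n t : ℕ} (hn : 4 ≤ n) (ht1 : 1 ≤ t) (ht : t ≤ n - 3) :
    ¬ Nonempty (Gnt n t ≃* ArtinD n) := by
  rintro ⟨e⟩
  obtain ⟨w, ⟨v, hv0, hv⟩, hw⟩ := exists_isPrimitiveRoot_radical hn ht1 ht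
  let q : (LaurentPolynomial ℤ)ˣ := (isUnit_T 1).unit
  let φ : LaurentPolynomial ℤ →+* ℂ := eval₂ (Int.castRingHom ℂ) w
  have hq : Units.map (φ : LaurentPolynomial ℤ →* ℂ) q = w :=
    Units.ext ((eval₂_T _ w 1).trans (by rw [zpow_one]))
  let ψ : ArtinD n →* (LaurentPolynomial ℤ)ˣ :=
    (Units.map detMonoidHom).comp ((burau q hn ht1 ht).comp e.symm.toMonoidHom)
  obtain ⟨u, hmem, hu⟩ := ArtinD_map_comm hn ψ
  have hone : Units.map (φ : LaurentPolynomial ℤ →* ℂ) u ^ ((n - 1) * 2) = 1 := by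
    have h1 := congrArg (fun M => M.map φ *ᵥ v) (burau_coxeterD hn ht1 ht q e hu)
    simp only [map_burau, hq, burau_mulVec_eq_self w hn ht1 ht hv] at h1
    obtain ⟨k, hk⟩ := Function.ne_iff.1 hv0
    have h2 := congrFun h1 k
    have h3 : (((u ^ ((n - 1) * 2) : (LaurentPolynomial ℤ)ˣ) : LaurentPolynomial ℤ) •
        (1 : Matrix (Fin n) (Fin n) (LaurentPolynomial ℤ))).map φ =
        φ ((u ^ ((n - 1) * 2) : (LaurentPolynomial ℤ)ˣ) : LaurentPolynomial ℤ) •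
          (1 : Matrix (Fin n) (Fin n) ℂ) := by
      ext i j
      simp [one_apply, apply_ite φ]
    rw [h3, smul_mulVec, one_mulVec, Pi.smul_apply, smul_eq_mul] at h2
    rw [← map_pow]
    exact Units.ext (mul_right_cancel₀ hk (h2.symm.trans (one_mul _).symm))
  obtain ⟨l, hl⟩ := hmem (e (PresentedGroup.mk _ (gen n 1)))
  have hψ : ψ (e (PresentedGroup.mk _ (gen n 1))) = -q := by
    refine Units.ext ?_
    change (burau q hn ht1 ht (e.symm (e _))).val.det = _
    rw [e.symm_apply_apply, burau_mk_gen q hn ht1 ht le_rfl (by omega),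
      det_burauGen q hn le_rfl (by omega)]
    rfl
  have hpow : (-q) ^ ((n - 1) * 2) = (u ^ ((n - 1) * 2)) ^ l := by
    rw [← hψ, ← hl]
    simpa only [zpow_natCast] using zpow_comm u l ((n - 1) * 2 : ℕ)
  apply hw
  have h4 := congrArg (Units.map (φ : LaurentPolynomial ℤ →* ℂ)) hpow
  rw [map_zpow, map_pow, map_pow, hone, _root_.one_zpow] at h4
  have h5 : Units.map (φ : LaurentPolynomial ℤ →* ℂ) (-q) = -w := by
    rw [← hq]
    exact Units.ext (map_neg φ _)
  rw [h5, mul_comm, pow_mul, neg_sq, ← pow_mul] at h4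
  rw [← Units.val_pow_eq_pow_val, h4, Units.val_one]

end Main

/-- Theorem 1.2 of the paper: for `n ≥ 4` and `1 ≤ t ≤ n-3`,
neither `Q_{n,t}` nor `G_{n,t}` is isomorphic to the Artin group `A(D_n)`. -/
theorem Qnt_Gnt_not_isom_ArtinD (n t : ℕ) (hn : 4 ≤ n) (ht1 : 1 ≤ t) (ht2 : t ≤ n - 3) :
    ¬ Nonempty (Qnt n t ≃* ArtinD n) ∧ ¬ Nonempty (Gnt n t ≃* ArtinD n) := by
  refine ⟨fun ⟨e⟩ => ArtinD_not_comm hn fun g h => ?_, Gnt_not_isom_ArtinD hn ht1 ht2⟩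
  simpa using (Qnt_commute hn (e.symm g) (e.symm h)).map e

end ArtinPaper
end

section
/- Let G be a group and let f, g, h ∈ G satisfy BR(f,g), BR(g,h) and CM(f,h). Then BR(f, g h g^{−1}), BR(f, g^{−1} h g), and BR(f, f g h g^{−1} f^{−1}). -/
/- Scaffolding: braid/commuting predicates, ordered products, cycle and twisted
cycle commutators, and the Artin groups of the diagrams `Δ_n`, `Δ_{t,n}`, `D_n`
(generators numbered `1, …, n` as in the paper, realized on the index type `Fin n`). -/

namespace ArtinPaper

open scoped commutatorElement

/-- The braid relation is preserved by simultaneous conjugation. -/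
theorem BR.conj {G : Type*} [Group G] {u v : G} (h : BR u v) (k : G) :
    BR (k * u * k⁻¹) (k * v * k⁻¹) := by
  unfold BR at *
  simpa [MulAut.conj_apply] using congrArg (MulAut.conj k) h

/-- Conjugating the second of two braiding elements by an element commuting with the first
preserves the braid relation. -/
theorem BR.conj_right {G : Type*} [Group G] {u v k : G} (h : BR u v) (hk : Commute k u) :
    BR u (k * v * k⁻¹) := by
  simpa [hk.eq] using h.conj k

theorem BR.inv_mul_mul_eq {G : Type*} [Group G] {u v : G} (h : BR u v) :
    u⁻¹ * v * u = v * u * v⁻¹ := by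
  rw [eq_mul_inv_iff_mul_eq, mul_assoc, mul_assoc, inv_mul_eq_iff_eq_mul, ← mul_assoc, ← mul_assoc]
  exact h.symm

/-- Lemma 2.2(i): if `BR f g`, `BR g h`, `CM f h`, then
`BR f (g h g⁻¹)`, `BR f (g⁻¹ h g)`, and `BR f (f g h g⁻¹ f⁻¹)`. -/
theorem brcm_braids {G : Type*} [Group G] (f g h : G)
    (h1 : BR f g) (h2 : BR g h) (h3 : CM f h) :
    BR f (g * h * g⁻¹) ∧ BR f (g⁻¹ * h * g) ∧ BR f (f * g * h * g⁻¹ * f⁻¹) := by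
  have hc : Commute h f := h3.symm
  have first : BR f (g * h * g⁻¹) := by
    have hg : BR h g := h2.symm
    simpa [← hg.inv_mul_mul_eq] using h1.conj_right hc.inv_left
  refine ⟨first, ?_, ?_⟩
  · rw [h2.inv_mul_mul_eq]
    exact h1.conj_right hc
  · simpa [mul_assoc] using first.conj_right (Commute.refl f)

end ArtinPaper
end

section
/- Let n ≥ 3 and let a_1, a_2, …, a_n be elements of a group G satisfying the defining relations of A(Δ_n), i.e. BR(a_i, a_{i+1}) for 1 ≤ i ≤ n−1, BR(a_n, a_1), and CM(a_i, a_j) for all other pairs i < j. Then the n conditions cc(a_1, a_2, …, a_n) = 1, cc(a_2, a_3, …, a_n, a_1) = 1, …, cc(a_n, a_1, …, a_{n−1}) = 1 (one for each cyclic rotation of the sequence a_1, …, a_n) are all equivalent. -/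
/- Scaffolding: braid/commuting predicates, ordered products, cycle and twisted
cycle commutators, and the Artin groups of the diagrams `Δ_n`, `Δ_{t,n}`, `D_n`
(generators numbered `1, …, n` as in the paper, realized on the index type `Fin n`). -/

namespace ArtinPaper

open scoped commutatorElement

/-- The `j`-th cyclic rotation of the sequence `y 1, …, y n`
(indices taken mod `n` in `{1, …, n}`, starting at `y j`). -/
def rot {G : Type*} [Group G] (y : ℕ → G) (n j : ℕ) : ℕ → G :=
  fun m => y ((j - 1 + (m - 1)) % n + 1)

/-- The product of the `k` consecutive terms `c s, …, c (s + k - 1)`. -/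
def consecProd {G : Type*} [Group G] (c : ℕ → G) (s k : ℕ) : G :=
  ((List.range k).map fun i => c (s + i)).prod

/-- The conjugate of `c (s + k)` by the product `c s ⋯ c (s + k - 1)`. -/
def consecConj {G : Type*} [Group G] (c : ℕ → G) (s k : ℕ) : G :=
  consecProd c s k * c (s + k) * (consecProd c s k)⁻¹

theorem consecProd_succ_left {G : Type*} [Group G] (c : ℕ → G) (s k : ℕ) :
    consecProd c s (k + 1) = c s * consecProd c (s + 1) k := by
  simp only [consecProd, List.range_succ_eq_map, List.map_cons, List.map_map, List.prod_cons,
    Nat.add_zero]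
  congr 3
  funext i
  simp only [Function.comp_apply]
  congr 1
  omega

theorem consecProd_succ_right {G : Type*} [Group G] (c : ℕ → G) (s k : ℕ) :
    consecProd c s (k + 1) = consecProd c s k * c (s + k) := by
  simp [consecProd, List.range_succ]

theorem consecConj_succ {G : Type*} [Group G] (c : ℕ → G) (s k : ℕ) :
    consecConj c s (k + 1) = c s * consecConj c (s + 1) k * (c s)⁻¹ := by
  have h : s + (k + 1) = s + 1 + k := by omega
  simp only [consecConj, consecProd_succ_left, h]
  group

theorem Commute.consecProd_right {G : Type*} [Group G] {c : ℕ → G} {x : G} {s k : ℕ}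
    (h : ∀ i < k, Commute x (c (s + i))) : Commute x (consecProd c s k) := by
  induction k with
  | zero => simp [consecProd]
  | succ k ih =>
    rw [consecProd_succ_right]
    exact (ih fun i hi => h i (by omega)).mul_right (h k (by omega))

theorem Commute.consecConj_right {G : Type*} [Group G] {c : ℕ → G} {x : G} {s k : ℕ}
    (h : ∀ i ≤ k, Commute x (c (s + i))) : Commute x (consecConj c s k) := by
  have hp : Commute x (consecProd c s k) := Commute.consecProd_right fun i hi => h i hi.le
  exact (hp.mul_right (h k le_rfl)).mul_right hp.inv_right

theorem BR.conj_eq {G : Type*} [Group G] {u v : G} (h : BR u v) :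
    u * v * u⁻¹ = v⁻¹ * u * v := by
  have h' : u * v * u = v * u * v := h
  rw [mul_inv_eq_iff_eq_mul, mul_assoc, mul_assoc, eq_inv_mul_iff_mul_eq, ← mul_assoc,
    ← mul_assoc, h']

theorem BR.conj_right_of_commute {G : Type*} [Group G] {x u v : G} (hxu : BR x u)
    (huv : BR u v) (hxv : Commute x v) : BR x (u * v * u⁻¹) := by
  have hx : x = v⁻¹ * x * v := by rw [mul_assoc, hxv.eq, inv_mul_cancel_left]
  have h : x * u * x = u * x * u := hxu
  rw [huv.conj_eq]
  change x * (v⁻¹ * u * v) * x = v⁻¹ * u * v * x * (v⁻¹ * u * v)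
  calc x * (v⁻¹ * u * v) * x
      = v⁻¹ * x * v * (v⁻¹ * u * v) * (v⁻¹ * x * v) := by rw [← hx]
    _ = v⁻¹ * (x * u * x) * v := by group
    _ = v⁻¹ * (u * x * u) * v := by rw [h]
    _ = v⁻¹ * u * v * (v⁻¹ * x * v) * (v⁻¹ * u * v) := by group
    _ = v⁻¹ * u * v * x * (v⁻¹ * u * v) := by rw [← hx]

theorem BR.consecConj_right {G : Type*} [Group G] {c : ℕ → G} {n : ℕ}
    (hb : ∀ i, BR (c i) (c (i + 1)))
    (hc : ∀ i d, 2 ≤ d → d + 2 ≤ n → Commute (c i) (c (i + d))) (k : ℕ) :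
    ∀ s, k + 3 ≤ n → BR (c s) (consecConj c (s + 1) k) := by
  induction k with
  | zero =>
    intro s _
    simpa [consecConj, consecProd] using hb s
  | succ k ih =>
    intro s hk
    rw [consecConj_succ]
    refine (hb s).conj_right_of_commute (ih (s + 1) (by omega)) ?_
    refine Commute.consecConj_right fun i hi => ?_
    rw [show s + 1 + 1 + i = s + (i + 2) by omega]
    exact hc s (i + 2) (by omega) (by omega)

theorem commute_consecConj_succ {G : Type*} [Group G] {c : ℕ → G} {m : ℕ}
    (hb : ∀ i, BR (c i) (c (i + 1)))
    (hc : ∀ i d, 2 ≤ d → d + 2 ≤ m + 3 → Commute (c i) (c (i + d)))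
    (hp : ∀ i, c (i + (m + 3)) = c i) {s : ℕ}
    (h : Commute (c s) (consecConj c (s + 1) (m + 1))) :
    Commute (c (s + 1)) (consecConj c (s + 2) (m + 1)) := by
  have hY : BR (c (s + 1)) (consecConj c (s + 2) m) :=
    BR.consecConj_right hb hc m (s + 1) le_rfl
  have hP : Commute (c s) (consecProd c (s + 2) m) := by
    refine Commute.consecProd_right fun i hi => ?_
    rw [show s + 2 + i = s + (i + 2) by omega]
    exact hc s (i + 2) (by omega) (by omega)
  rw [consecConj_succ, hY.conj_eq] at h
  have h' : Commute (consecConj c (s + 2) m * c s * (consecConj c (s + 2) m)⁻¹) (c (s + 1)) := by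
    have := (Commute.conj_iff (consecConj c (s + 2) m)).2 h
    simpa [mul_assoc] using this
  have hconj : consecConj c (s + 2) (m + 1) =
      consecConj c (s + 2) m * c s * (consecConj c (s + 2) m)⁻¹ := by
    have hlast : c (s + 2 + (m + 1)) = c s := by
      rw [← hp s]
      congr 1
      omega
    have hcs : (consecProd c (s + 2) m)⁻¹ * c s * consecProd c (s + 2) m = c s := by
      rw [mul_assoc, hP.eq, inv_mul_cancel_left]
    rw [consecConj, hlast, consecProd_succ_right]
    nth_rewrite 1 [← hcs]
    simp only [consecConj]
    group
  rw [hconj]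
  exact h'.symm

theorem cc_eq_one_iff_commute_consecConj {G : Type*} [Group G] (c : ℕ → G) (m s : ℕ) :
    cc (fun k => c (s + (k - 1))) (m + 3) = 1 ↔
      Commute (c s) (consecConj c (s + 1) (m + 1)) := by
  have h : mulIcc (fun k => c (s + (k - 1))) 2 (m + 3 - 1) = consecProd c (s + 1) (m + 1) := by
    simp only [mulIcc, consecProd]
    rw [show m + 3 - 1 + 1 - 2 = m + 1 by omega]
    congr 2
    funext i
    congr 1
    omega
  have h' : s + (m + 3 - 1) = s + 1 + (m + 1) := by omega
  rw [cc, h, commutatorElement_eq_one_iff_commute, consecConj]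
  simp only [h', Nat.sub_self, Nat.add_zero]

/-- Lemma 2.4: if `a 1, …, a n` satisfy the defining relations of
`A(Δ_n)`, then the `n` conditions `cc` of a cyclic rotation of the sequence `= 1`
are all equivalent. -/
theorem cc_rotation_equiv {G : Type*} [Group G] (n : ℕ) (hn : 3 ≤ n) (a : ℕ → G)
    (hbr : ∀ i, 1 ≤ i → i + 1 ≤ n → BR (a i) (a (i + 1)))
    (hbr' : BR (a n) (a 1))
    (hcm : ∀ i j, 1 ≤ i → i < j → j ≤ n → j ≠ i + 1 → ¬(i = 1 ∧ j = n) →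
      CM (a i) (a j)) :
    ∀ j j', 1 ≤ j → j ≤ n → 1 ≤ j' → j' ≤ n →
      (cc (rot a n j) n = 1 ↔ cc (rot a n j') n = 1) := by
  intro j j' hj hjn hj' hjn'
  obtain ⟨m, rfl⟩ : ∃ m, n = m + 3 := ⟨n - 3, by omega⟩
  obtain ⟨c, hcdef⟩ : ∃ c : ℕ → G, ∀ i, c i = a (i % (m + 3) + 1) := ⟨_, fun _ => rfl⟩
  have hp : ∀ i, c (i + (m + 3)) = c i := fun i => by simp [hcdef]
  have hb : ∀ i, BR (c i) (c (i + 1)) := by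
    intro i
    have hi := Nat.mod_lt i (show 0 < m + 3 by omega)
    rw [hcdef, hcdef, Nat.add_mod_eq_ite, Nat.mod_eq_of_lt (show 1 < m + 3 by omega)]
    split_ifs with h
    · have h1 : i % (m + 3) + 1 = m + 3 := by omega
      simpa [h1] using hbr'
    · exact hbr _ (by omega) (by omega)
  have hc : ∀ i d, 2 ≤ d → d + 2 ≤ m + 3 → Commute (c i) (c (i + d)) := by
    intro i d hd hd'
    have hi := Nat.mod_lt i (show 0 < m + 3 by omega)
    rw [hcdef, hcdef, Nat.add_mod_eq_ite, Nat.mod_eq_of_lt (show d < m + 3 by omega)]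
    split_ifs with h
    · exact Commute.symm (hcm _ _ (by omega) (by omega) (by omega) (by omega) (by omega))
    · exact hcm _ _ (by omega) (by omega) (by omega) (by omega) (by omega)
  have hrot : ∀ i, cc (rot a (m + 3) i) (m + 3) = 1 ↔
      Commute (c (i - 1)) (consecConj c (i - 1 + 1) (m + 1)) := by
    intro i
    rw [← cc_eq_one_iff_commute_consecConj]
    simp only [hcdef]
    rfl
  have hshift : ∀ s k, Commute (c s) (consecConj c (s + 1) (m + 1)) →
      Commute (c (s + k)) (consecConj c (s + k + 1) (m + 1)) := by
    intro s k h
    induction k with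
    | zero => exact h
    | succ k ih => exact commute_consecConj_succ hb hc hp ih
  have hper : ∀ s k, consecProd c (s + (m + 3)) k = consecProd c s k := by
    intro s k
    simp only [consecProd, add_right_comm s, hp]
  have himp : ∀ i i', 1 ≤ i → i ≤ m + 3 → cc (rot a (m + 3) i) (m + 3) = 1 →
      cc (rot a (m + 3) i') (m + 3) = 1 := by
    intro i i' hi hin h
    rw [hrot] at h ⊢
    have h2 := hshift _ (i' - 1 + (m + 3) - (i - 1)) h
    rw [show i - 1 + (i' - 1 + (m + 3) - (i - 1)) = i' - 1 + (m + 3) by omega, hp,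
      show i' - 1 + (m + 3) + 1 = i' - 1 + 1 + (m + 3) by omega, consecConj, hper,
      add_right_comm _ (m + 3) (m + 1), hp] at h2
    exact h2
  exact ⟨himp j j' hj hjn, himp j' j hj' hjn'⟩

end ArtinPaper
end
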